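/- arXiv:2006.11896 — 5 statements merged into one kernel-verified Lean document; each statement's English description precedes it below -/
import Mathlib

section
/- Let p > 1, m ≥ 1 an integer and ε > 0. There exist δ > 0 and a constant C (depending only on n, p, m, ε) such that for all weights u, v on ℝⁿ, with α_p(t) = t^p log^{p−1+δ}(e+t), γ_{p,m}(t) = t^{p'} log^{m(p'+δ)}(e+t), ψ_{p,m}(t) = t^{p'} log^{max((m+1)p'−1, mp'+1)+ε}(e+t) and ψ_{p',m}(t) = t^{p} log^{max((m+1)p−1, mp+1)+ε}(e+t) (p' = p/(p−1)), one has [u^{1/p}, v^{−1/p}]_{α_p, γ_{p,m}} ≤ C·([u^{1/p}, v^{−1/p}]_{t^p, ψ_{p,m}} + [u^{1/p}, v^{−1/p}]_{ψ_{p',m}, t^{p'}}). -/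
open MeasureTheory ENNReal Filter

noncomputable section

/-- A (half-open) cube in `ℝⁿ`. -/
structure Cube (n : ℕ) where
  corner : Fin n → ℝ
  side : ℝ
  side_pos : 0 < side

/-- The underlying set of a cube. -/
def Cube.set {n : ℕ} (Q : Cube n) : Set (Fin n → ℝ) :=
  Set.univ.pi fun i => Set.Ico (Q.corner i) (Q.corner i + Q.side)

/-- A weight: a non-negative, locally integrable function. -/
def IsWeight {n : ℕ} (w : (Fin n → ℝ) → ℝ) : Prop :=
  Measurable w ∧ (∀ x, 0 ≤ w x) ∧ LocallyIntegrable w volume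

/-- A sparse family of cubes with sparseness constant `α`. -/
def IsSparse {n : ℕ} (S : Set (Cube n)) (α : ℝ) : Prop :=
  ∃ E : Cube n → Set (Fin n → ℝ),
    (∀ Q ∈ S, E Q ⊆ Q.set ∧ MeasurableSet (E Q) ∧
      ENNReal.ofReal α * volume Q.set ≤ volume (E Q)) ∧
    S.Pairwise fun Q Q' => Disjoint (E Q) (E Q')

/-- The normalized Luxemburg norm `‖f‖_{φ,Q}` (with value `∞` if no λ works). -/
def luxNorm {n : ℕ} (φ : ℝ → ℝ) (Q : Set (Fin n → ℝ)) (f : (Fin n → ℝ) → ℝ) : ℝ≥0∞ :=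
  sInf {l : ℝ≥0∞ | ∃ c : ℝ, 0 < c ∧ l = ENNReal.ofReal c ∧
    (∫⁻ x in Q, ENNReal.ofReal (φ (|f x| / c))) ≤ volume Q}

/-- The sparse Orlicz operator `A_{L(log L)^m, S}`. -/
def sparseOrlicz {n : ℕ} (m : ℕ) (S : Set (Cube n)) (f : (Fin n → ℝ) → ℝ)
    (x : Fin n → ℝ) : ℝ≥0∞ :=
  ∑' Q : S, luxNorm (fun t => t * Real.log (Real.exp 1 + t) ^ m) Q.1.set f *
    Set.indicator Q.1.set (fun _ => (1 : ℝ≥0∞)) x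

/-- `L^p(w)` norm of an `ℝ≥0∞`-valued function. -/
def lpNormW {n : ℕ} (p : ℝ) (w : (Fin n → ℝ) → ℝ) (g : (Fin n → ℝ) → ℝ≥0∞) : ℝ≥0∞ :=
  (∫⁻ x, g x ^ p * ENNReal.ofReal (w x)) ^ (1 / p)

/-- `L^p(w)` norm of a real-valued function. -/
def lpNormR {n : ℕ} (p : ℝ) (w f : (Fin n → ℝ) → ℝ) : ℝ≥0∞ :=
  (∫⁻ x, ENNReal.ofReal |f x| ^ p * ENNReal.ofReal (w x)) ^ (1 / p)

/-- The two-weight bump constant `[g,h]_{A,B}`. -/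
def bump {n : ℕ} (A B : ℝ → ℝ) (g h : (Fin n → ℝ) → ℝ) : ℝ≥0∞ :=
  ⨆ Q : Cube n, luxNorm A Q.set g * luxNorm B Q.set h

/-- The logarithmic-bump Young function `t ↦ t^q (log(e+t))^a`. -/
def phiLog (q a : ℝ) : ℝ → ℝ := fun t => t ^ q * Real.log (Real.exp 1 + t) ^ a

lemma one_le_log_exp_one_add {x : ℝ} (hx : 0 ≤ x) : 1 ≤ Real.log (Real.exp 1 + x) := by
  rw [Real.le_log_iff_exp_le (by positivity)]
  linarith

lemma log_exp_one_add_mul_le {x y : ℝ} (hx : 0 ≤ x) (hy : 0 ≤ y) :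
    Real.log (Real.exp 1 + x * y) ≤
      Real.log (Real.exp 1 + x) + Real.log (Real.exp 1 + y) := by
  rw [← Real.log_mul (by positivity) (by positivity)]
  apply Real.log_le_log (by positivity)
  have h : 1 ≤ Real.exp 1 := Real.one_le_exp (by norm_num)
  nlinarith [mul_nonneg (sub_nonneg.2 h) hx, mul_nonneg (sub_nonneg.2 h) hy]

lemma exists_log_rpow_le {q B : ℝ} (hq : 0 < q) (hB : 0 < B) :
    ∃ K : ℝ, 0 ≤ K ∧ ∀ M : ℝ, 1 ≤ M → Real.log (Real.exp 1 + M) ^ B ≤ K * M ^ q := by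
  refine ⟨4 ^ q / (q / B) ^ B, by positivity, fun M hM => ?_⟩
  have hs : 0 < q / B := by positivity
  have h1 : Real.log (Real.exp 1 + M) ≤ (4 * M) ^ (q / B) / (q / B) := by
    refine (Real.log_le_log (by positivity) ?_).trans (Real.log_le_rpow_div (by positivity) hs)
    linarith [Real.exp_one_lt_d9]
  have h0 : 0 ≤ Real.log (Real.exp 1 + M) :=
    zero_le_one.trans (one_le_log_exp_one_add (by linarith))
  calc Real.log (Real.exp 1 + M) ^ B ≤ ((4 * M) ^ (q / B) / (q / B)) ^ B :=
        Real.rpow_le_rpow h0 h1 hB.le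
    _ = (4 * M) ^ q / (q / B) ^ B := by
        rw [Real.div_rpow (by positivity) hs.le, ← Real.rpow_mul (by positivity),
          div_mul_cancel₀ _ hB.ne']
    _ = 4 ^ q / (q / B) ^ B * M ^ q := by
        rw [Real.mul_rpow (by norm_num) (by linarith)]; ring

lemma phiLog_nonneg {q a t : ℝ} (ht : 0 ≤ t) : 0 ≤ phiLog q a t := by
  have := one_le_log_exp_one_add ht
  unfold phiLog
  positivity

lemma phiLog_mono_exponent {q a b t : ℝ} (hab : a ≤ b) (ht : 0 ≤ t) :
    phiLog q a t ≤ phiLog q b t :=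
  mul_le_mul_of_nonneg_left (Real.rpow_le_rpow_of_exponent_le (one_le_log_exp_one_add ht) hab)
    (by positivity)

lemma rpow_le_phiLog {q a t : ℝ} (ha : 0 ≤ a) (ht : 0 ≤ t) : t ^ q ≤ phiLog q a t := by
  simpa [phiLog] using phiLog_mono_exponent (q := q) ha ht

lemma phiLog_div_le {q a t l : ℝ} (hq : 1 ≤ q) (ha : 0 ≤ a) (ht : 0 ≤ t) (hl : 1 ≤ l) :
    phiLog q a (t / l) ≤ phiLog q a t / l := by
  have hl0 : 0 < l := by linarith
  have h1 : (t / l) ^ q ≤ t ^ q / l := by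
    rw [Real.div_rpow ht hl0.le]
    gcongr
    simpa using Real.rpow_le_rpow_of_exponent_le hl hq
  have h2 : Real.log (Real.exp 1 + t / l) ^ a ≤ Real.log (Real.exp 1 + t) ^ a := by
    refine Real.rpow_le_rpow (zero_le_one.trans (one_le_log_exp_one_add (by positivity))) ?_ ha
    have := div_le_self ht hl
    gcongr
  have h3 : 0 ≤ Real.log (Real.exp 1 + t / l) ^ a :=
    Real.rpow_nonneg (zero_le_one.trans (one_le_log_exp_one_add (by positivity))) _
  calc phiLog q a (t / l) ≤ t ^ q / l * Real.log (Real.exp 1 + t) ^ a :=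
        mul_le_mul h1 h2 h3 (by positivity)
    _ = phiLog q a t / l := by unfold phiLog; ring

/-- Pointwise interpolation between a power and a logarithmic bump. -/
lemma exists_phiLog_mul_le {q B θ : ℝ} (hq : 0 < q) (hB : 0 < B) (h0 : 0 ≤ θ) (h1 : θ ≤ 1) :
    ∃ K : ℝ, 1 ≤ K ∧ ∀ M x : ℝ, 1 ≤ M → 0 ≤ x →
      phiLog q (θ * B) (x * M ^ (1 - θ)) ≤ K * ((x * M) ^ q + phiLog q B x) := by
  obtain ⟨K₀, hK₀, hlog⟩ := exists_log_rpow_le hq hB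
  refine ⟨1 + 2 ^ B * (1 + K₀), by have : (0 : ℝ) ≤ 2 ^ B * (1 + K₀) := by positivity
                                   linarith, fun M x hM hx => ?_⟩
  have hM0 : 0 < M := by linarith
  set L := Real.log (Real.exp 1 + x * M) with hL
  set X := Real.log (Real.exp 1 + x) with hX
  set Y := Real.log (Real.exp 1 + M) with hY
  have hL1 : 1 ≤ L := one_le_log_exp_one_add (by positivity)
  have hX1 : 1 ≤ X := one_le_log_exp_one_add hx
  have hY1 : 1 ≤ Y := one_le_log_exp_one_add hM0.le
  have hXB : 0 ≤ X ^ B := by positivity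
  have hYB : 0 ≤ Y ^ B := by positivity
  have hsum : L ^ B ≤ 2 ^ B * (X ^ B + Y ^ B) := by
    have hle : L ≤ 2 * max X Y := by
      have := log_exp_one_add_mul_le hx hM0.le
      linarith [le_max_left X Y, le_max_right X Y]
    calc L ^ B ≤ (2 * max X Y) ^ B := Real.rpow_le_rpow (by linarith) hle hB.le
      _ = 2 ^ B * (max X Y) ^ B :=
          Real.mul_rpow (by norm_num) (by linarith [le_max_left X Y])
      _ ≤ 2 ^ B * (X ^ B + Y ^ B) := by
          gcongr
          rcases max_choice X Y with h | h <;> rw [h] <;> linarith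
  have hYM : Y ^ B ≤ K₀ * M ^ q := hlog M hM
  have hmono : Real.log (Real.exp 1 + x * M ^ (1 - θ)) ≤ L := by
    have : M ^ (1 - θ) ≤ M := by
      simpa using Real.rpow_le_rpow_of_exponent_le hM (by linarith : 1 - θ ≤ 1)
    rw [hL]
    gcongr
  have hamgm : (M ^ q) ^ (1 - θ) * (L ^ B) ^ θ ≤ M ^ q + L ^ B := by
    have h := Real.geom_mean_le_arith_mean2_weighted (by linarith : 0 ≤ 1 - θ) h0
      (by positivity : 0 ≤ M ^ q) (by positivity : 0 ≤ L ^ B) (by ring)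
    have h2 : 0 ≤ M ^ q := by positivity
    have h3 : 0 ≤ L ^ B := by positivity
    nlinarith [mul_nonneg h0 h2, mul_nonneg (by linarith : 0 ≤ 1 - θ) h3]
  have hbound : M ^ q + L ^ B ≤ (1 + 2 ^ B * (1 + K₀)) * (M ^ q + X ^ B) := by
    have h2 : 0 ≤ M ^ q := by positivity
    have h3 : (0 : ℝ) ≤ 2 ^ B := by positivity
    have h4 : 2 ^ B * Y ^ B ≤ 2 ^ B * (K₀ * M ^ q) := by gcongr
    nlinarith [mul_nonneg h3 h2, mul_nonneg h3 (mul_nonneg hK₀ hXB)]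
  have hxq : 0 ≤ x ^ q := by positivity
  calc phiLog q (θ * B) (x * M ^ (1 - θ))
      ≤ (x * M ^ (1 - θ)) ^ q * L ^ (θ * B) := by
        refine mul_le_mul_of_nonneg_left (Real.rpow_le_rpow ?_ hmono (by positivity))
          (by positivity)
        exact zero_le_one.trans (one_le_log_exp_one_add (by positivity))
    _ = x ^ q * ((M ^ q) ^ (1 - θ) * (L ^ B) ^ θ) := by
        rw [Real.mul_rpow hx (by positivity), ← Real.rpow_mul hM0.le, ← Real.rpow_mul hM0.le,
          ← Real.rpow_mul (by linarith), mul_comm q, mul_comm B]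
        ring
    _ ≤ x ^ q * ((1 + 2 ^ B * (1 + K₀)) * (M ^ q + X ^ B)) := by
        exact mul_le_mul_of_nonneg_left (hamgm.trans hbound) hxq
    _ = (1 + 2 ^ B * (1 + K₀)) * ((x * M) ^ q + phiLog q B x) := by
        rw [Real.mul_rpow hx hM0.le]
        unfold phiLog
        ring

lemma luxNorm_le_of_lintegral_le {n : ℕ} {φ : ℝ → ℝ} {Q : Set (Fin n → ℝ)}
    {f : (Fin n → ℝ) → ℝ} {c : ℝ} (hc : 0 < c)
    (h : (∫⁻ x in Q, ENNReal.ofReal (φ (|f x| / c))) ≤ volume Q) :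
    luxNorm φ Q f ≤ ENNReal.ofReal c :=
  sInf_le ⟨c, hc, rfl, h⟩

lemma exists_lintegral_le_of_luxNorm_lt {n : ℕ} {φ : ℝ → ℝ} {Q : Set (Fin n → ℝ)}
    {f : (Fin n → ℝ) → ℝ} {l : ℝ≥0∞} (h : luxNorm φ Q f < l) :
    ∃ c : ℝ, 0 < c ∧ ENNReal.ofReal c < l ∧
      (∫⁻ x in Q, ENNReal.ofReal (φ (|f x| / c))) ≤ volume Q := by
  obtain ⟨_, ⟨c, hc, rfl, hi⟩, hl⟩ := sInf_lt_iff.1 h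
  exact ⟨c, hc, hl, hi⟩

lemma luxNorm_mono {n : ℕ} {φ ψ : ℝ → ℝ} (h : ∀ t, 0 ≤ t → φ t ≤ ψ t) (Q : Set (Fin n → ℝ))
    (f : (Fin n → ℝ) → ℝ) : luxNorm φ Q f ≤ luxNorm ψ Q f := by
  refine le_sInf ?_
  rintro _ ⟨c, hc, rfl, hi⟩
  refine luxNorm_le_of_lintegral_le hc (le_trans (lintegral_mono fun x => ?_) hi)
  exact ENNReal.ofReal_le_ofReal (h _ (by positivity))

lemma Cube.volume_set_ne_top {n : ℕ} (Q : Cube n) : volume Q.set ≠ ∞ := by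
  have : volume Q.set = ∏ i : Fin n, ENNReal.ofReal (Q.corner i + Q.side - Q.corner i) :=
    Real.volume_pi_Ico
  rw [this]
  exact ENNReal.prod_ne_top fun i _ => ENNReal.ofReal_ne_top

/-- A function with vanishing normalized `L^q` norm has vanishing logarithmic bump norm. -/
lemma luxNorm_phiLog_eq_zero {n : ℕ} {Q : Cube n} {f : (Fin n → ℝ) → ℝ} (hf : Measurable f)
    {q : ℝ} (hq : 0 < q) (a : ℝ) (h : luxNorm (fun t => t ^ q) Q.set f = 0) :
    luxNorm (phiLog q a) Q.set f = 0 := by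
  have hint : (∫⁻ x in Q.set, ENNReal.ofReal (|f x| ^ q)) = 0 := by
    set I := ∫⁻ x in Q.set, ENNReal.ofReal (|f x| ^ q)
    have hle : ∀ r : ℝ, 0 < r → I ≤ ENNReal.ofReal r * volume Q.set := by
      intro r hr
      have hr' : 0 < r ^ (1 / q) := by positivity
      obtain ⟨c, hc, hcr, hi⟩ := exists_lintegral_le_of_luxNorm_lt
        (h.trans_lt (ENNReal.ofReal_pos.2 hr'))
      have hcr' : c ^ q ≤ r := by
        have hlt := (ENNReal.ofReal_lt_ofReal_iff hr').1 hcr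
        calc c ^ q ≤ (r ^ (1 / q)) ^ q := by gcongr
          _ = r := by rw [← Real.rpow_mul hr.le, one_div_mul_cancel hq.ne', Real.rpow_one]
      calc I = ∫⁻ x in Q.set, ENNReal.ofReal (c ^ q) * ENNReal.ofReal ((|f x| / c) ^ q) := by
            refine lintegral_congr fun x => ?_
            rw [← ENNReal.ofReal_mul (by positivity), ← Real.mul_rpow hc.le (by positivity),
              mul_div_cancel₀ _ hc.ne']
        _ = ENNReal.ofReal (c ^ q) * ∫⁻ x in Q.set, ENNReal.ofReal ((|f x| / c) ^ q) :=
            lintegral_const_mul' _ _ ENNReal.ofReal_ne_top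
        _ ≤ ENNReal.ofReal r * volume Q.set :=
            mul_le_mul' (ENNReal.ofReal_le_ofReal hcr') hi
    refine le_antisymm (ENNReal.le_of_forall_pos_le_add fun s hs _ => ?_) zero_le
    have hs' : (0 : ℝ) < s := by exact_mod_cast hs
    have hV : 0 ≤ (volume Q.set).toReal := ENNReal.toReal_nonneg
    refine (hle (s / ((volume Q.set).toReal + 1)) (by positivity)).trans ?_
    rw [zero_add, ← ENNReal.ofReal_coe_nnreal, ← ENNReal.ofReal_toReal Q.volume_set_ne_top,
      ← ENNReal.ofReal_mul (by positivity), ENNReal.toReal_ofReal hV]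
    refine ENNReal.ofReal_le_ofReal ?_
    rw [div_mul_eq_mul_div, div_le_iff₀ (by positivity)]
    linarith
  have hae : ∀ᵐ x ∂volume.restrict Q.set, |f x| = 0 := by
    rw [lintegral_eq_zero_iff (by fun_prop)] at hint
    filter_upwards [hint] with x hx
    have : |f x| ^ q ≤ 0 := by simpa using hx
    have h0 := le_antisymm this (by positivity)
    exact (Real.rpow_eq_zero (abs_nonneg _) hq.ne').1 h0
  refine le_antisymm (ENNReal.le_of_forall_pos_le_add fun r hr _ => ?_) zero_le
  rw [zero_add, ← ENNReal.ofReal_coe_nnreal]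
  refine luxNorm_le_of_lintegral_le (by exact_mod_cast hr) ?_
  have : (∫⁻ x in Q.set, ENNReal.ofReal (phiLog q a (|f x| / r))) = 0 := by
    rw [← lintegral_zero (μ := volume.restrict Q.set)]
    refine lintegral_congr_ae ?_
    filter_upwards [hae] with x hx
    simp [hx, phiLog, Real.zero_rpow hq.ne']
  rw [this]
  exact zero_le

lemma exists_luxNorm_phiLog_le_of_lintegral_le {q B θ : ℝ} (hq : 1 ≤ q) (hB : 0 < B)
    (h0 : 0 ≤ θ) (h1 : θ ≤ 1) :
    ∃ K : ℝ, 0 < K ∧ ∀ (n : ℕ) (Q : Set (Fin n → ℝ)) (f : (Fin n → ℝ) → ℝ), Measurable f →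
      ∀ c d : ℝ, 0 < c → 0 < d →
      (∫⁻ x in Q, ENNReal.ofReal ((|f x| / c) ^ q)) ≤ volume Q →
      (∫⁻ x in Q, ENNReal.ofReal (phiLog q B (|f x| / d))) ≤ volume Q →
      luxNorm (phiLog q (θ * B)) Q f ≤ ENNReal.ofReal (K * (c ^ (1 - θ) * d ^ θ)) := by
  obtain ⟨K, hK, hpt⟩ := exists_phiLog_mul_le (by linarith : 0 < q) hB h0 h1
  have hK0 : 0 < K := by linarith
  refine ⟨2 * K, by positivity, fun n Q f hf => ?_⟩
  have key : ∀ c d : ℝ, 0 < c → c ≤ d →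
      (∫⁻ x in Q, ENNReal.ofReal ((|f x| / c) ^ q)) ≤ volume Q →
      (∫⁻ x in Q, ENNReal.ofReal (phiLog q B (|f x| / d))) ≤ volume Q →
      luxNorm (phiLog q (θ * B)) Q f ≤ ENNReal.ofReal (2 * K * (c ^ (1 - θ) * d ^ θ)) := by
    intro c d hc hcd hic hid
    have hd : 0 < d := hc.trans_le hcd
    refine luxNorm_le_of_lintegral_le (by positivity) ?_
    have hx : ∀ x, phiLog q (θ * B) (|f x| / (2 * K * (c ^ (1 - θ) * d ^ θ))) ≤
        2⁻¹ * ((|f x| / c) ^ q + phiLog q B (|f x| / d)) := by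
      intro x
      have hP := hpt (d / c) (|f x| / d) ((one_le_div hc).2 hcd) (by positivity)
      have e1 : |f x| / d * (d / c) ^ (1 - θ) = |f x| / (c ^ (1 - θ) * d ^ θ) := by
        have : d = d ^ (1 - θ) * d ^ θ := by
          rw [← Real.rpow_add hd, sub_add_cancel, Real.rpow_one]
        rw [Real.div_rpow hd.le hc.le]
        nth_rewrite 1 [this]
        field_simp
      have e2 : |f x| / d * (d / c) = |f x| / c := by field_simp
      rw [e1, e2] at hP
      have hD := phiLog_div_le (t := |f x| / (c ^ (1 - θ) * d ^ θ)) (l := 2 * K) hq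
        (mul_nonneg h0 hB.le) (by positivity) (by linarith)
      rw [div_div, mul_comm _ (2 * K)] at hD
      refine hD.trans ?_
      rw [div_le_iff₀ (by positivity)]
      linarith
    calc (∫⁻ x in Q, ENNReal.ofReal (phiLog q (θ * B)
            (|f x| / (2 * K * (c ^ (1 - θ) * d ^ θ)))))
        ≤ ∫⁻ x in Q, ENNReal.ofReal 2⁻¹ * (ENNReal.ofReal ((|f x| / c) ^ q) +
            ENNReal.ofReal (phiLog q B (|f x| / d))) := by
          refine lintegral_mono fun x => ?_
          rw [← ENNReal.ofReal_add (by positivity) (phiLog_nonneg (by positivity)),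
            ← ENNReal.ofReal_mul (by norm_num)]
          exact ENNReal.ofReal_le_ofReal (hx x)
      _ = ENNReal.ofReal 2⁻¹ * ((∫⁻ x in Q, ENNReal.ofReal ((|f x| / c) ^ q)) +
            ∫⁻ x in Q, ENNReal.ofReal (phiLog q B (|f x| / d))) := by
          rw [lintegral_const_mul' _ _ ENNReal.ofReal_ne_top, lintegral_add_left (by fun_prop)]
      _ ≤ ENNReal.ofReal 2⁻¹ * (volume Q + volume Q) := by gcongr
      _ = volume Q := by
          rw [ENNReal.ofReal_inv_of_pos two_pos, ENNReal.ofReal_ofNat, ← two_mul, ← mul_assoc,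
            ENNReal.inv_mul_cancel (by norm_num) (by norm_num), one_mul]
  intro c d hc hd hic hid
  rcases le_total c d with hcd | hdc
  · exact key c d hc hcd hic hid
  · refine (key d d hd le_rfl (le_trans (lintegral_mono fun x => ?_) hid) hid).trans ?_
    · exact ENNReal.ofReal_le_ofReal (rpow_le_phiLog hB.le (by positivity))
    · refine ENNReal.ofReal_le_ofReal ?_
      have : 0 ≤ 1 - θ := by linarith
      gcongr

/-- Interpolation of Luxemburg norms between a power and a logarithmic bump. -/
lemma exists_luxNorm_phiLog_le {q B θ : ℝ} (hq : 1 ≤ q) (hB : 0 < B)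
    (h0 : 0 ≤ θ) (h1 : θ ≤ 1) :
    ∃ K : ℝ, 0 < K ∧ ∀ (n : ℕ) (Q : Set (Fin n → ℝ)) (f : (Fin n → ℝ) → ℝ), Measurable f →
      luxNorm (fun t => t ^ q) Q f ≠ 0 → luxNorm (phiLog q B) Q f ≠ ∞ →
      luxNorm (phiLog q (θ * B)) Q f ≤ ENNReal.ofReal K *
        (luxNorm (fun t => t ^ q) Q f ^ (1 - θ) * luxNorm (phiLog q B) Q f ^ θ) := by
  obtain ⟨K, hK, hlux⟩ := exists_luxNorm_phiLog_le_of_lintegral_le hq hB h0 h1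
  refine ⟨K * 2, by positivity, fun n Q f hf hne hfin => ?_⟩
  have hle : luxNorm (fun t => t ^ q) Q f ≤ luxNorm (phiLog q B) Q f :=
    luxNorm_mono (fun t ht => rpow_le_phiLog hB.le ht) Q f
  set N := luxNorm (fun t => t ^ q) Q f
  set P := luxNorm (phiLog q B) Q f
  have lt_two_mul : ∀ a : ℝ≥0∞, a ≠ 0 → a ≠ ∞ → a < 2 * a := fun a ha ha' => by
    rw [two_mul]; exact ENNReal.lt_add_right ha' ha
  have hP0 : P ≠ 0 := fun h => hne (le_antisymm (h ▸ hle) zero_le)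
  obtain ⟨c, hc, hcN, hic⟩ := exists_lintegral_le_of_luxNorm_lt
    (lt_two_mul N hne (ne_top_of_le_ne_top hfin hle))
  obtain ⟨d, hd, hdP, hid⟩ := exists_lintegral_le_of_luxNorm_lt (lt_two_mul P hP0 hfin)
  have h1' : 0 ≤ 1 - θ := by linarith
  calc luxNorm (phiLog q (θ * B)) Q f ≤ ENNReal.ofReal (K * (c ^ (1 - θ) * d ^ θ)) :=
        hlux n Q f hf c d hc hd hic hid
    _ = ENNReal.ofReal K * (ENNReal.ofReal c ^ (1 - θ) * ENNReal.ofReal d ^ θ) := by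
        rw [ENNReal.ofReal_mul hK.le, ENNReal.ofReal_mul (by positivity),
          ENNReal.ofReal_rpow_of_pos hc, ENNReal.ofReal_rpow_of_pos hd]
    _ ≤ ENNReal.ofReal K * ((2 * N) ^ (1 - θ) * (2 * P) ^ θ) := by gcongr
    _ = ENNReal.ofReal (K * 2) * (N ^ (1 - θ) * P ^ θ) := by
        have h2 : (2 : ℝ≥0∞) ^ (1 - θ) * 2 ^ θ = 2 := by
          rw [← ENNReal.rpow_add _ _ two_ne_zero ofNat_ne_top, sub_add_cancel, ENNReal.rpow_one]
        rw [ENNReal.mul_rpow_of_nonneg _ _ h1', ENNReal.mul_rpow_of_nonneg _ _ h0,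
          mul_mul_mul_comm, h2, ENNReal.ofReal_mul hK.le, ENNReal.ofReal_ofNat, mul_assoc]

/-- Product of two interpolated Luxemburg norms with complementary exponents. -/
lemma exists_luxNorm_mul_luxNorm_le {q r A B θ : ℝ} (hq : 1 ≤ q) (hr : 1 ≤ r)
    (hA : 0 < A) (hB : 0 < B) (h0 : 0 ≤ θ) (h1 : θ ≤ 1) :
    ∃ C : ℝ, 0 < C ∧ ∀ (n : ℕ) (Q : Cube n) (f g : (Fin n → ℝ) → ℝ), Measurable f →
      Measurable g →
      luxNorm (phiLog q (θ * B)) Q.set f * luxNorm (phiLog r ((1 - θ) * A)) Q.set g ≤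
        ENNReal.ofReal C *
          (luxNorm (fun t => t ^ q) Q.set f * luxNorm (phiLog r A) Q.set g +
            luxNorm (phiLog q B) Q.set f * luxNorm (fun t => t ^ r) Q.set g) := by
  have h1' : 0 ≤ 1 - θ := by linarith
  obtain ⟨K, hK, hf'⟩ := exists_luxNorm_phiLog_le hq hB h0 h1
  obtain ⟨L, hL, hg'⟩ := exists_luxNorm_phiLog_le hr hA h1' (by linarith)
  refine ⟨K * L, by positivity, fun n Q f g hf hg => ?_⟩
  by_cases hN : luxNorm (fun t => t ^ q) Q.set f = 0
  · simp [luxNorm_phiLog_eq_zero hf (by linarith) (θ * B) hN]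
  by_cases hM : luxNorm (fun t => t ^ r) Q.set g = 0
  · simp [luxNorm_phiLog_eq_zero hg (by linarith) ((1 - θ) * A) hM]
  have hKL : ENNReal.ofReal (K * L) ≠ 0 := (ENNReal.ofReal_pos.2 (by positivity)).ne'
  by_cases hP : luxNorm (phiLog q B) Q.set f = ∞
  · simp [hP, ENNReal.top_mul hM, ENNReal.mul_top hKL]
  by_cases hR : luxNorm (phiLog r A) Q.set g = ∞
  · simp [hR, ENNReal.mul_top hN, ENNReal.mul_top hKL]
  refine (mul_le_mul' (hf' n Q.set f hf hN hP) (hg' n Q.set g hg hM hR)).trans ?_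
  set N := luxNorm (fun t => t ^ q) Q.set f
  set M := luxNorm (fun t => t ^ r) Q.set g
  set P := luxNorm (phiLog q B) Q.set f
  set R := luxNorm (phiLog r A) Q.set g
  rw [mul_mul_mul_comm, ← ENNReal.ofReal_mul hK.le, _root_.sub_sub_cancel]
  gcongr
  calc N ^ (1 - θ) * P ^ θ * (M ^ θ * R ^ (1 - θ))
      = (N * R) ^ (1 - θ) * (P * M) ^ θ := by
        rw [ENNReal.mul_rpow_of_nonneg _ _ h1', ENNReal.mul_rpow_of_nonneg _ _ h0]
        ring
    _ ≤ (N * R + P * M) ^ (1 - θ) * (N * R + P * M) ^ θ := by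
        gcongr
        · exact le_self_add
        · exact le_add_self
    _ = N * R + P * M := by
        rw [← ENNReal.rpow_add_of_nonneg _ _ h1' h0, sub_add_cancel, ENNReal.rpow_one]

/-- **Bump comparison used in Corollary: `[u^{1/p},v^{-1/p}]_{α_p,γ_{p,m}}` is controlled by
the separated bumps with `ψ_{p,m}` and `ψ_{p',m}`.** -/
theorem bump_gamma_le_separated (n : ℕ) (p : ℝ) (hp : 1 < p)
    (m : ℕ) (hm : 1 ≤ m) (ε : ℝ) (hε : 0 < ε) :
    ∃ δ C : ℝ, 0 < δ ∧ 0 < C ∧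
      ∀ u v : (Fin n → ℝ) → ℝ, IsWeight u → IsWeight v →
        bump (phiLog p (p - 1 + δ))
            (phiLog (p / (p - 1)) ((m : ℝ) * (p / (p - 1) + δ)))
            (fun x => u x ^ (1 / p)) (fun x => v x ^ (-(1 / p))) ≤
          ENNReal.ofReal C *
            (bump (fun t => t ^ p)
                (phiLog (p / (p - 1))
                  (max (((m : ℝ) + 1) * (p / (p - 1)) - 1) ((m : ℝ) * (p / (p - 1)) + 1) + ε))
                (fun x => u x ^ (1 / p)) (fun x => v x ^ (-(1 / p))) +
              bump (phiLog p (max (((m : ℝ) + 1) * p - 1) ((m : ℝ) * p + 1) + ε))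
                (fun t => t ^ (p / (p - 1)))
                (fun x => u x ^ (1 / p)) (fun x => v x ^ (-(1 / p)))) := by
  have hp0 : 0 < p := by linarith
  have hp1 : 0 < p - 1 := by linarith
  have hm0 : (1 : ℝ) ≤ m := by exact_mod_cast hm
  set r := p / (p - 1) with hr
  have hr1 : 1 ≤ r := by rw [hr, le_div_iff₀ hp1]; linarith
  set B := max (((m : ℝ) + 1) * p - 1) ((m : ℝ) * p + 1) + ε with hB
  set A := max (((m : ℝ) + 1) * r - 1) ((m : ℝ) * r + 1) + ε with hA
  have hD : 0 < ((m : ℝ) + 1) * p - 1 := by nlinarith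
  set D := ((m : ℝ) + 1) * p - 1 with hDdef
  have hBD : D + ε ≤ B := by rw [hB]; gcongr; exact le_max_left _ _
  have hE : 0 < (m : ℝ) * r + 1 := by positivity
  set E := (m : ℝ) * r + 1 with hEdef
  have hAE : E + ε ≤ A := by rw [hA]; gcongr; exact le_max_right _ _
  set θ := (p - 1) / D with hθ
  have hθ0 : 0 < θ := by positivity
  have hθ' : 1 - θ = m * r / E := by
    have hED : E * (p - 1) = D := by
      rw [hEdef, hDdef, hr]; field_simp; ring
    have : θ = 1 / E := by
      rw [hθ, ← hED]; field_simp
    rw [this, eq_div_iff hE.ne', sub_mul, one_div_mul_cancel hE.ne', hEdef]; ring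
  have hθ1 : θ ≤ 1 := by
    have : 0 ≤ 1 - θ := by rw [hθ']; positivity
    linarith
  obtain ⟨C, hC, hmain⟩ := exists_luxNorm_mul_luxNorm_le hp.le hr1 (by linarith : 0 < A)
    (by linarith : 0 < B) hθ0.le hθ1
  set δ := min (θ * ε) (r / E * ε) with hδ
  have hδ1 : δ ≤ θ * ε := min_le_left _ _
  have hδ2 : δ ≤ r / E * ε := min_le_right _ _
  have ha : p - 1 + δ ≤ θ * B := by
    have h : θ * D = p - 1 := by rw [hθ]; field_simp
    nlinarith
  have hb : (m : ℝ) * (r + δ) ≤ (1 - θ) * A := by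
    have h : (1 - θ) * E = m * r := by rw [hθ']; field_simp
    have h2 : (m : ℝ) * δ ≤ (1 - θ) * ε := by
      calc (m : ℝ) * δ ≤ m * (r / E * ε) := by gcongr
        _ = (1 - θ) * ε := by rw [hθ']; ring
    have h3 : (1 - θ) * (E + ε) ≤ (1 - θ) * A :=
      mul_le_mul_of_nonneg_left hAE (by linarith)
    linarith
  refine ⟨δ, C, lt_min (by positivity) (by positivity), hC, fun u v hu hv => ?_⟩
  refine iSup_le fun Q => ?_
  refine (mul_le_mul' (luxNorm_mono (fun t ht => phiLog_mono_exponent ha ht) _ _)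
    (luxNorm_mono (fun t ht => phiLog_mono_exponent hb ht) _ _)).trans ?_
  refine (hmain n Q _ _ (hu.1.pow_const _) (hv.1.pow_const _)).trans ?_
  unfold bump
  gcongr
  · exact le_iSup (fun Q : Cube n => luxNorm (fun t => t ^ p) Q.set (fun x => u x ^ (1 / p)) *
      luxNorm (phiLog r A) Q.set (fun x => v x ^ (-(1 / p)))) Q
  · exact le_iSup (fun Q : Cube n => luxNorm (phiLog p B) Q.set (fun x => u x ^ (1 / p)) *
      luxNorm (fun t => t ^ r) Q.set (fun x => v x ^ (-(1 / p)))) Q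

end
end

section
/- Let D be a dyadic lattice in ℝⁿ, S ⊆ D, and let {a_P}_{P∈S} be non-negative numbers. Then for every integer l ≥ 1 there is a constant C_l (depending only on l) such that for every cube Q ∈ D and every x, (Σ_{P∈S, P⊆Q} a_P·χ_P(x))^l ≤ C_l·Σ_{P_l ⊆ P_{l−1} ⊆ … ⊆ P₁ ⊆ Q, P_i ∈ S} a_{P₁}·a_{P₂}·…·a_{P_l}·χ_{P_l}(x), where the sum runs over all chains of cubes P₁, …, P_l in S with P_l ⊆ P_{l−1} ⊆ … ⊆ P₁ ⊆ Q. -/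
open MeasureTheory ENNReal Filter

noncomputable section

/-- A dyadic child of a cube, indexed by `ε ∈ {0,1}ⁿ`. -/
def Cube.child {n : ℕ} (Q : Cube n) (ε : Fin n → Bool) : Cube n :=
  ⟨fun i => Q.corner i + (if ε i then Q.side / 2 else 0), Q.side / 2,
    by have := Q.side_pos; linarith⟩

/-- `P` is obtained from `R` by repeated dyadic subdivision. -/
def Cube.IsDescendantOf {n : ℕ} (P R : Cube n) : Prop :=
  Relation.ReflTransGen (fun X Y => ∃ ε, X = Y.child ε) P R

/-- A dyadic lattice. -/
def IsDyadicLattice {n : ℕ} (D : Set (Cube n)) : Prop :=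
  (∀ Q ∈ D, ∀ ε, Q.child ε ∈ D) ∧
  (∀ Q ∈ D, ∀ Q' ∈ D, ∃ R ∈ D, Q.IsDescendantOf R ∧ Q'.IsDescendantOf R) ∧
  (∀ Kc : Set (Fin n → ℝ), IsCompact Kc → ∃ Q ∈ D, Kc ⊆ Q.set)

/-- A decreasing chain `P_l ⊆ ⋯ ⊆ P₁ ⊆ Q` of cubes of `S` (encoded as a function
`ℕ → Cube n` which is constantly `Q` from index `l` on). -/
def IsDownChain {n : ℕ} (S : Set (Cube n)) (l : ℕ) (Q : Cube n)
    (P : ℕ → Cube n) : Prop :=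
  (∀ i < l, P i ∈ S) ∧ (∀ i, i + 1 < l → (P (i + 1)).set ⊆ (P i).set) ∧
  (0 < l → (P 0).set ⊆ Q.set) ∧ (∀ i, l ≤ i → P i = Q)

namespace Cube

variable {n : ℕ}

theorem mem_set {Q : Cube n} {x : Fin n → ℝ} :
    x ∈ Q.set ↔ ∀ i, Q.corner i ≤ x i ∧ x i < Q.corner i + Q.side := by
  simp [Cube.set]

theorem child_set_subset (Q : Cube n) (ε : Fin n → Bool) : (Q.child ε).set ⊆ Q.set := by
  intro x hx
  rw [mem_set] at hx ⊢
  intro i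
  have h := hx i
  have hs := Q.side_pos
  simp only [child] at h
  split_ifs at h <;> constructor <;> linarith [h.1, h.2]

theorem child_eq_child_of_mem {Q : Cube n} {ε δ : Fin n → Bool} {x : Fin n → ℝ}
    (hε : x ∈ (Q.child ε).set) (hδ : x ∈ (Q.child δ).set) : Q.child ε = Q.child δ := by
  rw [mem_set] at hε hδ
  congr 1
  funext i
  have h₁ := hε i
  have h₂ := hδ i
  simp only [child] at h₁ h₂
  cases hi : ε i <;> cases hj : δ i <;> simp [hi, hj] at h₁ h₂ ⊢ <;> linarith [h₁.1, h₁.2]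

theorem IsDescendantOf.set_subset {P R : Cube n} (h : P.IsDescendantOf R) :
    P.set ⊆ R.set := by
  induction h with
  | refl => exact subset_rfl
  | tail _ hYZ ih =>
    obtain ⟨ε, rfl⟩ := hYZ
    exact ih.trans (child_set_subset _ ε)

theorem IsDescendantOf.eq_or_side_lt {P R : Cube n} (h : P.IsDescendantOf R) :
    P = R ∨ P.side < R.side := by
  induction h with
  | refl => exact Or.inl rfl
  | @tail Y Z _ hYZ ih =>
    obtain ⟨ε, rfl⟩ := hYZ
    have hlt : (Z.child ε).side < Z.side := half_lt_self Z.side_pos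
    rcases ih with rfl | ih
    · exact Or.inr hlt
    · exact Or.inr (ih.trans hlt)

/-- The step relation from a cube to its child containing `x`, iterated from an ancestor,
reaches every descendant containing `x`. -/
theorem IsDescendantOf.reflTransGen_of_mem {P R : Cube n} {x : Fin n → ℝ}
    (h : P.IsDescendantOf R) (hx : x ∈ P.set) :
    Relation.ReflTransGen (fun X Y : Cube n => (∃ ε, Y = X.child ε) ∧ x ∈ Y.set) R P := by
  induction h using Relation.ReflTransGen.head_induction_on with
  | refl => exact .refl
  | head hPY _ ih =>
    obtain ⟨ε, rfl⟩ := hPY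
    exact (ih (child_set_subset _ ε hx)).tail ⟨⟨ε, rfl⟩, hx⟩

theorem IsDescendantOf.of_reflTransGen {P R : Cube n} {x : Fin n → ℝ}
    (h : Relation.ReflTransGen (fun X Y : Cube n => (∃ ε, Y = X.child ε) ∧ x ∈ Y.set) R P) :
    P.IsDescendantOf R := by
  induction h with
  | refl => exact .refl
  | tail _ hYZ ih => exact Relation.ReflTransGen.head hYZ.1 ih

theorem IsDescendantOf.total_of_mem {P P' R : Cube n} {x : Fin n → ℝ}
    (h : P.IsDescendantOf R) (h' : P'.IsDescendantOf R) (hx : x ∈ P.set) (hx' : x ∈ P'.set) :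
    P.IsDescendantOf P' ∨ P'.IsDescendantOf P := by
  have hu : Relator.RightUnique
      (fun X Y : Cube n => (∃ ε, Y = X.child ε) ∧ x ∈ Y.set) := by
    rintro X _ _ ⟨⟨ε, rfl⟩, hε⟩ ⟨⟨δ, rfl⟩, hδ⟩
    exact child_eq_child_of_mem hε hδ
  exact (Relation.ReflTransGen.total_of_right_unique hu (h.reflTransGen_of_mem hx)
    (h'.reflTransGen_of_mem hx')).symm.imp .of_reflTransGen .of_reflTransGen

end Cube

theorem IsDyadicLattice.set_subset_of_side_le {n : ℕ} {D : Set (Cube n)}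
    (hD : IsDyadicLattice D) {P P' : Cube n} (hP : P ∈ D) (hP' : P' ∈ D) {x : Fin n → ℝ}
    (hx : x ∈ P.set) (hx' : x ∈ P'.set) (hle : P.side ≤ P'.side) : P.set ⊆ P'.set := by
  obtain ⟨R, -, h, h'⟩ := hD.2.1 P hP P' hP'
  rcases h.total_of_mem h' hx hx' with hd | hd
  · exact hd.set_subset
  · rcases hd.eq_or_side_lt with rfl | hlt
    · exact subset_rfl
    · exact absurd hlt hle.not_gt

theorem ENNReal.tsum_pow_eq_tsum_prod {α : Type*} (w : α → ℝ≥0∞) (l : ℕ) :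
    (∑' t, w t) ^ l = ∑' f : Fin l → α, ∏ i, w (f i) := by
  induction l with
  | zero => simp
  | succ l ih =>
    rw [pow_succ', ih, ← (Fin.consEquiv fun _ => α).tsum_eq, ENNReal.tsum_prod',
      ← ENNReal.tsum_mul_right]
    refine tsum_congr fun t => ?_
    rw [← ENNReal.tsum_mul_left]
    exact tsum_congr fun f => by simp [Fin.consEquiv, Fin.prod_univ_succ]

/-- If every tuple with nonzero weight can be rearranged so as to satisfy `p`, the `l`-th power
of a sum is at most `l!` times the sum over the tuples satisfying `p`. -/
theorem ENNReal.tsum_pow_le_factorial_mul {α : Type*} (w : α → ℝ≥0∞) (l : ℕ)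
    (p : (Fin l → α) → Prop)
    (hp : ∀ f : Fin l → α, (∀ i, w (f i) ≠ 0) → ∃ σ : Equiv.Perm (Fin l), p (f ∘ σ)) :
    (∑' t, w t) ^ l ≤ (l.factorial : ℝ≥0∞) * ∑' f : {f // p f}, ∏ i, w (f.1 i) := by
  set G : (Fin l → α) → ℝ≥0∞ := Set.indicator {f | p f} fun f => ∏ i, w (f i) with hG
  calc (∑' t, w t) ^ l = ∑' f : Fin l → α, ∏ i, w (f i) := tsum_pow_eq_tsum_prod w l
    _ ≤ ∑' f : Fin l → α, ∑ σ : Equiv.Perm (Fin l), G (f ∘ σ) := by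
      refine ENNReal.tsum_le_tsum fun f => ?_
      by_cases hf : ∀ i, w (f i) ≠ 0
      · obtain ⟨σ, hσ⟩ := hp f hf
        refine le_trans (le_of_eq ?_)
          (Finset.single_le_sum (fun _ _ => zero_le) (Finset.mem_univ σ))
        rw [hG, Set.indicator_of_mem (show f ∘ σ ∈ {f | p f} from hσ)]
        exact (Equiv.prod_comp σ fun i => w (f i)).symm
      · push Not at hf
        obtain ⟨i, hi⟩ := hf
        rw [Finset.prod_eq_zero (Finset.mem_univ i) hi]
        exact zero_le
    _ = ∑ σ : Equiv.Perm (Fin l), ∑' f : Fin l → α, G (f ∘ σ) :=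
      Summable.tsum_finsetSum fun _ _ => ENNReal.summable
    _ = ∑ _σ : Equiv.Perm (Fin l), ∑' f, G f :=
      Finset.sum_congr rfl fun σ _ => (σ.symm.arrowCongr (Equiv.refl α)).tsum_eq G
    _ = (l.factorial : ℝ≥0∞) * ∑' f, G f := by
      simp [Fintype.card_perm]
    _ = _ := by rw [hG, ← tsum_subtype]; rfl

/-- **Lemma: the `l`-th power of `Σ_{P∈S,P⊆Q} a_P χ_P` is dominated by the sum over
chains of length `l`.** -/
theorem pow_sum_le_chain_sum (l : ℕ) (hl : 1 ≤ l) :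
    ∃ C : ℝ, 0 < C ∧
      ∀ (n : ℕ) (D : Set (Cube n)), IsDyadicLattice D →
        ∀ S : Set (Cube n), S ⊆ D →
          ∀ a : Cube n → ℝ, (∀ P, 0 ≤ a P) →
            ∀ Q ∈ D, ∀ x : Fin n → ℝ,
              (∑' P : {P : Cube n // P ∈ S ∧ P.set ⊆ Q.set},
                  ENNReal.ofReal (a P.1) *
                    Set.indicator P.1.set (fun _ => (1 : ℝ≥0∞)) x) ^ l ≤
                ENNReal.ofReal C *
                  ∑' P : {P : ℕ → Cube n // IsDownChain S l Q P},
                    (∏ i ∈ Finset.range l, ENNReal.ofReal (a (P.1 i))) *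
                      Set.indicator (P.1 (l - 1)).set (fun _ => (1 : ℝ≥0∞)) x := by
  refine ⟨l.factorial, by exact_mod_cast l.factorial_pos, ?_⟩
  intro n D hD S hS a _ Q _ x
  rw [ENNReal.ofReal_natCast]
  set U := {P : Cube n // P ∈ S ∧ P.set ⊆ Q.set}
  refine (ENNReal.tsum_pow_le_factorial_mul _ l
    (fun f : Fin l → U => Antitone fun i => (f i).1.set) fun f hf => ?_).trans ?_
  · have hx : ∀ i, x ∈ (f i).1.set := fun i =>
      Set.mem_of_indicator_ne_zero (right_ne_zero_of_mul (hf i))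
    refine ⟨Tuple.sort fun i => -(f i).1.side, fun i j hij => ?_⟩
    have hs := Tuple.monotone_sort (fun i => -(f i).1.side) hij
    exact hD.set_subset_of_side_le (hS (f _).2.1) (hS (f _).2.1) (hx _) (hx _)
      (neg_le_neg_iff.mp hs)
  · gcongr
    let e : {f : Fin l → U // Antitone fun i => (f i).1.set} →
        {P : ℕ → Cube n // IsDownChain S l Q P} := fun f =>
      ⟨fun i => if h : i < l then (f.1 ⟨i, h⟩).1 else Q, by
        refine ⟨fun i hi => ?_, fun i hi => ?_, fun h0 => ?_, fun i hi => ?_⟩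
        · simpa [hi] using (f.1 ⟨i, hi⟩).2.1
        · have hi' : i < l := by omega
          simp only [hi, hi', dif_pos]
          exact f.2 (Fin.mk_le_mk.mpr i.le_succ)
        · simpa [h0] using (f.1 ⟨0, h0⟩).2.2
        · simp [hi.not_gt]⟩
    have he : Function.Injective e := by
      intro f g hfg
      refine Subtype.ext (funext fun i => Subtype.ext ?_)
      simpa [e] using congrFun (congrArg Subtype.val hfg) i
    refine le_trans (ENNReal.tsum_le_tsum fun f => ?_)
      (ENNReal.tsum_comp_le_tsum_of_injective he _)
    have hl' : l - 1 < l := by omega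
    have hprod : ∏ i ∈ Finset.range l, ENNReal.ofReal (a ((e f).1 i)) =
        ∏ i : Fin l, ENNReal.ofReal (a (f.1 i).1) := by
      rw [Finset.prod_range]
      simp [e]
    have hlast : (e f).1 (l - 1) = (f.1 ⟨l - 1, hl'⟩).1 := by simp [e, hl']
    rw [hprod, hlast, Finset.prod_mul_distrib]
    gcongr
    rw [← Finset.mul_prod_erase _ _ (Finset.mem_univ (⟨l - 1, hl'⟩ : Fin l))]
    refine mul_le_of_le_one_right' (Finset.prod_le_one' fun i _ => ?_)
    exact Set.indicator_le_self' (by simp) x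

end
end

section
/- Let f ∈ BMO(ℝⁿ) and let R be a cube with f_R = 0 (where f_R = (1/|R|)∫_R f). Then there exists a function φ such that φ = f almost everywhere on R, φ = 0 almost everywhere on ℝⁿ∖2R (2R being the cube concentric with R of twice the side length), and ‖φ‖_{BMO} ≤ C_n·‖f‖_{BMO}, with C_n depending only on the dimension n. -/
open MeasureTheory ENNReal Filter

noncomputable section

/-- The double `2R` of a cube: concentric with twice the side length. -/
def Cube.double {n : ℕ} (Q : Cube n) : Cube n :=
  ⟨fun i => Q.corner i - Q.side / 2, 2 * Q.side, by have := Q.side_pos; linarith⟩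

/-- Average of a function over a cube. -/
def cubeAvg {n : ℕ} (f : (Fin n → ℝ) → ℝ) (Q : Cube n) : ℝ :=
  (∫ x in Q.set, f x) / (volume Q.set).toReal

/-- The `BMO` norm. -/
def bmoNorm {n : ℕ} (b : (Fin n → ℝ) → ℝ) : ℝ≥0∞ :=
  ⨆ Q : Cube n, (∫⁻ x in Q.set, ENNReal.ofReal |b x - cubeAvg b Q|) / volume Q.set

/-- The dilate of a cube by `2 ^ k` with the same corner. -/
def Cube.scale {n : ℕ} (Q : Cube n) (k : ℕ) : Cube n :=
  ⟨Q.corner, 2 ^ k * Q.side, by have := Q.side_pos; positivity⟩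

lemma Cube.mem_set_s10 {n : ℕ} (Q : Cube n) (x : Fin n → ℝ) :
    x ∈ Q.set ↔ ∀ i, Q.corner i ≤ x i ∧ x i < Q.corner i + Q.side := by
  simp [Cube.set, Set.mem_pi]

lemma Cube.corner_mem {n : ℕ} (Q : Cube n) : Q.corner ∈ Q.set :=
  (Q.mem_set_s10 _).2 fun i => ⟨le_rfl, by linarith [Q.side_pos]⟩

lemma Cube.measurableSet {n : ℕ} (Q : Cube n) : MeasurableSet Q.set :=
  MeasurableSet.univ_pi fun _ => measurableSet_Ico

lemma Cube.volume_set {n : ℕ} (Q : Cube n) :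
    volume Q.set = ENNReal.ofReal (Q.side ^ n) := by
  simp [Cube.set, volume_pi_pi, ENNReal.ofReal_pow Q.side_pos.le]

lemma Cube.volume_real {n : ℕ} (Q : Cube n) : volume.real Q.set = Q.side ^ n := by
  rw [measureReal_def, Q.volume_set, ENNReal.toReal_ofReal (pow_nonneg Q.side_pos.le _)]

lemma Cube.volume_lt_top {n : ℕ} (Q : Cube n) : volume Q.set < ⊤ := by
  rw [Q.volume_set]; exact ENNReal.ofReal_lt_top

lemma Cube.integrableOn {n : ℕ} (Q : Cube n) {f : (Fin n → ℝ) → ℝ}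
    (hf : LocallyIntegrable f volume) : IntegrableOn f Q.set volume := by
  refine (hf.integrableOn_isCompact
    (isCompact_univ_pi fun i => isCompact_Icc (a := Q.corner i)
      (b := Q.corner i + Q.side))).mono_set ?_
  exact Set.pi_mono fun i _ => Set.Ico_subset_Icc_self

lemma Cube.integrableOn_abs_sub {n : ℕ} (Q : Cube n) {f : (Fin n → ℝ) → ℝ}
    (hf : LocallyIntegrable f volume) (c : ℝ) :
    IntegrableOn (fun x => |f x - c|) Q.set volume :=
  ((Q.integrableOn hf).sub (integrableOn_const Q.volume_lt_top.ne)).abs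

lemma setIntegral_eq_cubeAvg_mul {n : ℕ} (f : (Fin n → ℝ) → ℝ) (Q : Cube n) :
    ∫ x in Q.set, f x = cubeAvg f Q * Q.side ^ n := by
  have h : (Q.side ^ n) ≠ 0 := (pow_pos Q.side_pos n).ne'
  rw [cubeAvg, ← measureReal_def, Q.volume_real, div_mul_cancel₀ _ h]

lemma abs_cubeAvg_sub_mul_le {n : ℕ} {f : (Fin n → ℝ) → ℝ}
    (hf : LocallyIntegrable f volume) (Q : Cube n) (c : ℝ) :
    |cubeAvg f Q - c| * Q.side ^ n ≤ ∫ x in Q.set, |f x - c| := by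
  have h1 : ∫ x in Q.set, (f x - c) = (cubeAvg f Q - c) * Q.side ^ n := by
    rw [integral_sub (Q.integrableOn hf) (integrableOn_const Q.volume_lt_top.ne),
      setIntegral_eq_cubeAvg_mul, setIntegral_const, Q.volume_real, smul_eq_mul]
    ring
  have h2 : |∫ x in Q.set, (f x - c)| ≤ ∫ x in Q.set, |f x - c| :=
    abs_integral_le_integral_abs
  rwa [h1, abs_mul, abs_of_pos (pow_pos Q.side_pos n)] at h2

/-- The mean oscillation is at most twice the mean deviation from any constant. -/
lemma setIntegral_abs_sub_cubeAvg_le {n : ℕ} {f : (Fin n → ℝ) → ℝ}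
    (hf : LocallyIntegrable f volume) (Q : Cube n) (c : ℝ) :
    ∫ x in Q.set, |f x - cubeAvg f Q| ≤ 2 * ∫ x in Q.set, |f x - c| := by
  have h1 : ∫ x in Q.set, |f x - cubeAvg f Q| ≤
      ∫ x in Q.set, (|f x - c| + |cubeAvg f Q - c|) := by
    refine setIntegral_mono (Q.integrableOn_abs_sub hf _)
      ((Q.integrableOn_abs_sub hf c).add (integrableOn_const Q.volume_lt_top.ne)) fun x => ?_
    have := abs_sub_le (f x) c (cubeAvg f Q)
    rwa [abs_sub_comm c] at this
  rw [integral_add (Q.integrableOn_abs_sub hf c) (integrableOn_const Q.volume_lt_top.ne),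
    setIntegral_const, Q.volume_real, smul_eq_mul, mul_comm (Q.side ^ n)] at h1
  linarith [abs_cubeAvg_sub_mul_le hf Q c]

lemma lintegral_ofReal_abs_sub {n : ℕ} {f : (Fin n → ℝ) → ℝ}
    (hf : LocallyIntegrable f volume) (Q : Cube n) (c : ℝ) :
    ∫⁻ x in Q.set, ENNReal.ofReal |f x - c| =
      ENNReal.ofReal (∫ x in Q.set, |f x - c|) :=
  (ofReal_integral_eq_lintegral_ofReal (Q.integrableOn_abs_sub hf c)
    (Eventually.of_forall fun _ => abs_nonneg _)).symm

lemma setIntegral_abs_sub_le_bmoNorm {n : ℕ} {f : (Fin n → ℝ) → ℝ}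
    (hf : LocallyIntegrable f volume) (hb : bmoNorm f < ⊤) (Q : Cube n) :
    ∫ x in Q.set, |f x - cubeAvg f Q| ≤ (bmoNorm f).toReal * Q.side ^ n := by
  have hpos := pow_pos Q.side_pos n
  have h : (∫⁻ x in Q.set, ENNReal.ofReal |f x - cubeAvg f Q|) / volume Q.set ≤ bmoNorm f :=
    le_iSup (fun Q : Cube n =>
      (∫⁻ x in Q.set, ENNReal.ofReal |f x - cubeAvg f Q|) / volume Q.set) Q
  rw [lintegral_ofReal_abs_sub hf, Q.volume_set, ← ENNReal.ofReal_div_of_pos hpos] at h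
  rw [← div_le_iff₀ hpos]
  exact (ENNReal.ofReal_le_iff_le_toReal hb.ne).1 h

lemma bmoNorm_le_ofReal {n : ℕ} {f : (Fin n → ℝ) → ℝ}
    (hf : LocallyIntegrable f volume) {B : ℝ}
    (h : ∀ Q : Cube n, ∫ x in Q.set, |f x - cubeAvg f Q| ≤ B * Q.side ^ n) :
    bmoNorm f ≤ ENNReal.ofReal B := by
  refine iSup_le fun Q => ?_
  have hpos := pow_pos Q.side_pos n
  rw [lintegral_ofReal_abs_sub hf, Q.volume_set, ← ENNReal.ofReal_div_of_pos hpos]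
  exact ENNReal.ofReal_le_ofReal ((div_le_iff₀ hpos).2 (h Q))

/-- Averages over nested cubes of comparable size differ by a multiple of the oscillation. -/
lemma abs_cubeAvg_sub_cubeAvg_le {n : ℕ} {f : (Fin n → ℝ) → ℝ}
    (hf : LocallyIntegrable f volume) {B : ℝ} (hB : 0 ≤ B)
    (h : ∀ Q : Cube n, ∫ x in Q.set, |f x - cubeAvg f Q| ≤ B * Q.side ^ n)
    {Q S : Cube n} (hQS : Q.set ⊆ S.set) {t : ℝ} (ht : S.side ≤ t * Q.side) :
    |cubeAvg f Q - cubeAvg f S| ≤ t ^ n * B := by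
  have hpos := pow_pos Q.side_pos n
  have h1 := abs_cubeAvg_sub_mul_le hf Q (cubeAvg f S)
  have h2 : ∫ x in Q.set, |f x - cubeAvg f S| ≤ ∫ x in S.set, |f x - cubeAvg f S| :=
    setIntegral_mono_set (S.integrableOn_abs_sub hf _)
      (Eventually.of_forall fun _ => abs_nonneg _) hQS.eventuallyLE
  have h3 : B * S.side ^ n ≤ B * (t * Q.side) ^ n :=
    mul_le_mul_of_nonneg_left (pow_le_pow_left₀ S.side_pos.le ht n) hB
  rw [mul_pow] at h3
  refine le_of_mul_le_mul_right ?_ hpos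
  calc _ ≤ _ := (h1.trans h2).trans ((h S).trans h3)
    _ = _ := by ring

lemma abs_cubeAvg_sub_cubeAvg_scale_le {n : ℕ} {f : (Fin n → ℝ) → ℝ}
    (hf : LocallyIntegrable f volume) {B : ℝ} (hB : 0 ≤ B)
    (h : ∀ Q : Cube n, ∫ x in Q.set, |f x - cubeAvg f Q| ≤ B * Q.side ^ n)
    (Q : Cube n) (k : ℕ) :
    |cubeAvg f Q - cubeAvg f (Q.scale k)| ≤ k * (2 ^ n * B) := by
  induction k with
  | zero => simp [Cube.scale]
  | succ k ih =>
    have hs := Q.side_pos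
    have hk : (0 : ℝ) < 2 ^ k * Q.side := by positivity
    have h1 := abs_cubeAvg_sub_cubeAvg_le hf hB h (Q := Q.scale k) (S := Q.scale (k + 1)) (t := 2)
      (by
        intro x hx
        rw [Cube.mem_set_s10] at hx ⊢
        intro i
        have := hx i
        simp only [Cube.scale, pow_succ] at this ⊢
        exact ⟨this.1, by linarith⟩)
      (by simp only [Cube.scale, pow_succ]; linarith)
    have h2 := abs_sub_le (cubeAvg f Q) (cubeAvg f (Q.scale k)) (cubeAvg f (Q.scale (k + 1)))
    push_cast
    linarith

lemma Cube.subset_double {n : ℕ} (R : Cube n) : R.set ⊆ R.double.set := by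
  intro x hx
  rw [Cube.mem_set_s10] at hx ⊢
  intro i
  have := hx i
  have := R.side_pos
  simp only [Cube.double]
  constructor <;> linarith

/-- The average over a small cube meeting `2R` grows at most like the ratio of side lengths. -/
lemma abs_cubeAvg_mul_side_le {n : ℕ} {f : (Fin n → ℝ) → ℝ}
    (hf : LocallyIntegrable f volume) {B : ℝ} (hB : 0 ≤ B)
    (h : ∀ Q : Cube n, ∫ x in Q.set, |f x - cubeAvg f Q| ≤ B * Q.side ^ n)
    {R Q : Cube n} (hR : cubeAvg f R = 0) (hQ : Q.side ≤ R.side)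
    {z : Fin n → ℝ} (hzQ : z ∈ Q.set) (hzR : z ∈ R.double.set) :
    |cubeAvg f Q| * Q.side ≤ (2 * 2 ^ n + 2 * 8 ^ n) * B * R.side := by
  have hq := Q.side_pos
  have hr := R.side_pos
  obtain ⟨k, hk1, hk2⟩ := exists_nat_pow_near (x := R.side / Q.side) (y := 2)
    ((one_le_div hq).2 hQ) one_lt_two
  rw [le_div_iff₀ hq] at hk1
  rw [div_lt_iff₀ hq, pow_succ] at hk2
  have hkk : (k : ℝ) ≤ 2 ^ k := by exact_mod_cast k.lt_two_pow_self.le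
  let S : Cube n := ⟨fun i => R.corner i - 3 / 2 * R.side, 4 * R.side, by positivity⟩
  have hRS : R.set ⊆ S.set := by
    intro x hx
    rw [Cube.mem_set_s10] at hx ⊢
    intro i
    have := hx i
    simp only [S]
    constructor <;> linarith
  have hQS : (Q.scale k).set ⊆ S.set := by
    intro x hx
    rw [Cube.mem_set_s10] at hx hzQ hzR ⊢
    intro i
    have h1 := hx i
    have h2 := hzQ i
    have h3 := hzR i
    simp only [S, Cube.scale, Cube.double] at h1 h3 ⊢
    constructor <;> linarith
  have e1 := abs_cubeAvg_sub_cubeAvg_scale_le hf hB h Q k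
  have e2 := abs_cubeAvg_sub_cubeAvg_le hf hB h hQS (t := 8)
    (by simp only [S, Cube.scale]; linarith)
  have e3 := abs_cubeAvg_sub_cubeAvg_le hf hB h hRS (t := 8) (by simp only [S]; linarith)
  have e4 : |cubeAvg f Q| ≤ k * (2 ^ n * B) + 2 * (8 ^ n * B) := by
    rw [hR] at e3
    rw [abs_le] at e1 e2 e3 ⊢
    constructor <;> linarith
  have e5 : (k : ℝ) * Q.side ≤ 2 * R.side := by nlinarith
  have p2 : (0 : ℝ) ≤ 2 ^ n * B := by positivity
  have p8 : (0 : ℝ) ≤ 8 ^ n * B := by positivity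
  nlinarith [mul_le_mul_of_nonneg_right e4 hq.le, mul_le_mul_of_nonneg_left e5 p2,
    mul_le_mul_of_nonneg_left hQ p8]

/-- A Lipschitz cutoff equal to `1` on `R` and vanishing off `2R`. -/
def Cube.cutoff {n : ℕ} (R : Cube n) (x : Fin n → ℝ) : ℝ :=
  max 0 (1 - 2 / R.side * Metric.infDist x R.set)

lemma Cube.cutoff_nonneg {n : ℕ} (R : Cube n) (x : Fin n → ℝ) : 0 ≤ R.cutoff x :=
  le_max_left _ _

lemma Cube.cutoff_le_one {n : ℕ} (R : Cube n) (x : Fin n → ℝ) : R.cutoff x ≤ 1 := by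
  have := R.side_pos
  have h : 0 ≤ 2 / R.side * Metric.infDist x R.set :=
    mul_nonneg (by positivity) Metric.infDist_nonneg
  exact max_le zero_le_one (by linarith)

lemma Cube.continuous_cutoff {n : ℕ} (R : Cube n) : Continuous R.cutoff :=
  continuous_const.max
    (continuous_const.sub (continuous_const.mul (Metric.continuous_infDist_pt _)))

lemma Cube.cutoff_eq_one {n : ℕ} (R : Cube n) {x : Fin n → ℝ} (hx : x ∈ R.set) :
    R.cutoff x = 1 := by
  simp [Cube.cutoff, Metric.infDist_zero_of_mem hx]

lemma Cube.cutoff_eq_zero {n : ℕ} (R : Cube n) {x : Fin n → ℝ} (hx : x ∉ R.double.set) :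
    R.cutoff x = 0 := by
  have hr := R.side_pos
  have h : R.side / 2 ≤ Metric.infDist x R.set := by
    refine (Metric.le_infDist ⟨_, R.corner_mem⟩).2 fun y hy => ?_
    by_contra! hd
    refine hx ((Cube.mem_set_s10 _ _).2 fun i => ?_)
    have h1 := (dist_le_pi_dist x y i).trans_lt hd
    rw [Real.dist_eq, abs_lt] at h1
    have h2 := (Cube.mem_set_s10 _ _).1 hy i
    simp only [Cube.double]
    constructor <;> linarith
  refine max_eq_left ?_
  have h1 : 2 / R.side * (R.side / 2) ≤ 2 / R.side * Metric.infDist x R.set :=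
    mul_le_mul_of_nonneg_left h (by positivity)
  have h2 : 2 / R.side * (R.side / 2) = 1 := by field_simp
  linarith

lemma Cube.abs_cutoff_sub_le {n : ℕ} (R : Cube n) (x y : Fin n → ℝ) :
    |R.cutoff x - R.cutoff y| ≤ 2 / R.side * dist x y := by
  have hr := R.side_pos
  refine (abs_max_sub_max_le_max _ _ _ _).trans ?_
  have h : |Metric.infDist y R.set - Metric.infDist x R.set| ≤ dist x y := by
    rw [abs_sub_comm]
    simpa [Real.dist_eq] using (Metric.lipschitz_infDist_pt R.set).dist_le_mul x y
  have h2 : (1 - 2 / R.side * Metric.infDist x R.set) -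
      (1 - 2 / R.side * Metric.infDist y R.set) =
      2 / R.side * (Metric.infDist y R.set - Metric.infDist x R.set) := by ring
  have h3 : 0 ≤ 2 / R.side := by positivity
  rw [h2, abs_mul, abs_of_nonneg h3, sub_self, abs_zero]
  exact max_le (by positivity) (mul_le_mul_of_nonneg_left h h3)

lemma Cube.dist_corner_le {n : ℕ} (Q : Cube n) {x : Fin n → ℝ} (hx : x ∈ Q.set) :
    dist x Q.corner ≤ Q.side := by
  refine (dist_pi_le_iff Q.side_pos.le).2 fun i => ?_
  have := (Q.mem_set_s10 x).1 hx i
  rw [Real.dist_eq, abs_le]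
  constructor <;> linarith [Q.side_pos]

lemma Cube.abs_cutoff_mul_le {n : ℕ} (R : Cube n) (f : (Fin n → ℝ) → ℝ) (x : Fin n → ℝ) :
    |R.cutoff x * f x| ≤ |f x| := by
  rw [abs_mul, abs_of_nonneg (R.cutoff_nonneg x)]
  exact mul_le_of_le_one_left (abs_nonneg _) (R.cutoff_le_one x)

lemma Cube.locallyIntegrable_cutoff_mul {n : ℕ} (R : Cube n) {f : (Fin n → ℝ) → ℝ}
    (hf : LocallyIntegrable f volume) :
    LocallyIntegrable (fun x => R.cutoff x * f x) volume :=
  hf.mono (R.continuous_cutoff.aestronglyMeasurable.mul hf.aestronglyMeasurable)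
    (Eventually.of_forall fun x => R.abs_cutoff_mul_le f x)

lemma setIntegral_abs_cutoff_mul_le_of_side_le {n : ℕ} {f : (Fin n → ℝ) → ℝ}
    (hf : LocallyIntegrable f volume) {B : ℝ} (hB : 0 ≤ B)
    (h : ∀ Q : Cube n, ∫ x in Q.set, |f x - cubeAvg f Q| ≤ B * Q.side ^ n)
    {R Q : Cube n} (hR : cubeAvg f R = 0) (hQ : R.side ≤ Q.side) :
    ∫ x in Q.set, |R.cutoff x * f x| ≤ 2 ^ n * (1 + 2 ^ n) * B * Q.side ^ n := by
  have hr := R.side_pos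
  have hφ := R.locallyIntegrable_cutoff_mul hf
  set D := R.double with hD
  have hDs : D.side = 2 * R.side := rfl
  have e1 : ∫ x in Q.set, |R.cutoff x * f x| ≤ ∫ x in D.set, |R.cutoff x * f x| := by
    rw [← integral_indicator Q.measurableSet, ← integral_indicator D.measurableSet]
    refine integral_mono ((integrable_indicator_iff Q.measurableSet).2 (Q.integrableOn hφ).abs)
      ((integrable_indicator_iff D.measurableSet).2 (D.integrableOn hφ).abs) fun x => ?_
    by_cases hx : x ∈ D.set
    · rw [Set.indicator_of_mem hx]
      exact Set.indicator_le_self' (fun _ _ => abs_nonneg _) x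
    · simp [Set.indicator, hx, R.cutoff_eq_zero hx]
  have e2 : ∫ x in D.set, |R.cutoff x * f x| ≤
      ∫ x in D.set, (|f x - cubeAvg f D| + |cubeAvg f D|) := by
    refine setIntegral_mono (D.integrableOn hφ).abs
      ((D.integrableOn_abs_sub hf _).add (integrableOn_const D.volume_lt_top.ne)) fun x => ?_
    refine (R.abs_cutoff_mul_le f x).trans ?_
    simpa using abs_add_le (f x - cubeAvg f D) (cubeAvg f D)
  rw [integral_add (D.integrableOn_abs_sub hf _) (integrableOn_const D.volume_lt_top.ne),
    setIntegral_const, D.volume_real, smul_eq_mul] at e2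
  have e3 := abs_cubeAvg_sub_cubeAvg_le hf hB h R.subset_double (t := 2) le_rfl
  rw [hR, zero_sub, abs_neg] at e3
  have hpos : 0 ≤ D.side ^ n := (pow_pos D.side_pos n).le
  have e4 : D.side ^ n ≤ 2 ^ n * Q.side ^ n := by
    rw [← mul_pow]
    exact pow_le_pow_left₀ D.side_pos.le (by linarith) n
  have e5 : 0 ≤ (1 + 2 ^ n) * B := by positivity
  nlinarith [h D, mul_le_mul_of_nonneg_left e3 hpos, mul_le_mul_of_nonneg_left e4 e5]

lemma setIntegral_abs_cutoff_mul_sub_le_of_le_side {n : ℕ} {f : (Fin n → ℝ) → ℝ}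
    (hf : LocallyIntegrable f volume) {B : ℝ} (hB : 0 ≤ B)
    (h : ∀ Q : Cube n, ∫ x in Q.set, |f x - cubeAvg f Q| ≤ B * Q.side ^ n)
    {R Q : Cube n} (hR : cubeAvg f R = 0) (hQ : Q.side ≤ R.side)
    {z : Fin n → ℝ} (hzQ : z ∈ Q.set) (hzR : z ∈ R.double.set) :
    ∫ x in Q.set, |R.cutoff x * f x - R.cutoff Q.corner * cubeAvg f Q| ≤
      (1 + 2 * (2 * 2 ^ n + 2 * 8 ^ n)) * B * Q.side ^ n := by
  have hr := R.side_pos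
  have hφ := R.locallyIntegrable_cutoff_mul hf
  have hA := abs_cubeAvg_mul_side_le hf hB h hR hQ hzQ hzR
  set M : ℝ := (2 * 2 ^ n + 2 * 8 ^ n) * B with hM
  have e1 : ∫ x in Q.set, |R.cutoff x * f x - R.cutoff Q.corner * cubeAvg f Q| ≤
      ∫ x in Q.set, (|f x - cubeAvg f Q| + 2 * M) := by
    refine setIntegral_mono_on (Q.integrableOn_abs_sub hφ _)
      ((Q.integrableOn_abs_sub hf _).add (integrableOn_const Q.volume_lt_top.ne))
      Q.measurableSet fun x hx => ?_
    have e : R.cutoff x * f x - R.cutoff Q.corner * cubeAvg f Q =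
        R.cutoff x * (f x - cubeAvg f Q) +
          (R.cutoff x - R.cutoff Q.corner) * cubeAvg f Q := by ring
    rw [e]
    refine (abs_add_le _ _).trans (add_le_add ?_ ?_)
    · exact R.abs_cutoff_mul_le (fun x => f x - cubeAvg f Q) x
    · rw [abs_mul]
      calc |R.cutoff x - R.cutoff Q.corner| * |cubeAvg f Q|
          ≤ 2 / R.side * Q.side * |cubeAvg f Q| := by
            refine mul_le_mul_of_nonneg_right ?_ (abs_nonneg _)
            exact (R.abs_cutoff_sub_le _ _).trans
              (mul_le_mul_of_nonneg_left (Q.dist_corner_le hx) (by positivity))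
        _ = 2 / R.side * (|cubeAvg f Q| * Q.side) := by ring
        _ ≤ 2 / R.side * (M * R.side) := mul_le_mul_of_nonneg_left hA (by positivity)
        _ = 2 * M := by field_simp
  rw [integral_add (Q.integrableOn_abs_sub hf _) (integrableOn_const Q.volume_lt_top.ne),
    setIntegral_const, Q.volume_real, smul_eq_mul] at e1
  calc _ ≤ _ := e1
    _ ≤ B * Q.side ^ n + Q.side ^ n * (2 * M) := by gcongr; exact h Q
    _ = _ := by rw [hM]; ring

/-- **Theorem (Jones-type extension of a BMO function from a cube).** -/
theorem bmo_extension_from_cube (n : ℕ) :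
    ∃ C : ℝ, 0 < C ∧
      ∀ f : (Fin n → ℝ) → ℝ, LocallyIntegrable f volume → bmoNorm f < ⊤ →
        ∀ R : Cube n, cubeAvg f R = 0 →
          ∃ φ : (Fin n → ℝ) → ℝ, LocallyIntegrable φ volume ∧
            (∀ᵐ x ∂(volume : Measure (Fin n → ℝ)), x ∈ R.set → φ x = f x) ∧
            (∀ᵐ x ∂(volume : Measure (Fin n → ℝ)), x ∉ R.double.set → φ x = 0) ∧
            bmoNorm φ ≤ ENNReal.ofReal C * bmoNorm f := by
  refine ⟨2 * (2 ^ n * (1 + 2 ^ n) + (1 + 2 * (2 * 2 ^ n + 2 * 8 ^ n))), by positivity, ?_⟩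
  intro f hf hb R hR
  have hφ := R.locallyIntegrable_cutoff_mul hf
  refine ⟨fun x => R.cutoff x * f x, hφ,
    Eventually.of_forall fun x hx => by simp [R.cutoff_eq_one hx],
    Eventually.of_forall fun x hx => by simp [R.cutoff_eq_zero hx], ?_⟩
  have h := setIntegral_abs_sub_le_bmoNorm hf hb
  have hB : 0 ≤ (bmoNorm f).toReal := ENNReal.toReal_nonneg
  rw [← ENNReal.ofReal_toReal hb.ne, ← ENNReal.ofReal_mul (by positivity)]
  generalize (bmoNorm f).toReal = B at h hB ⊢
  refine bmoNorm_le_ofReal hφ fun Q => ?_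
  have hpos : 0 ≤ Q.side ^ n := (pow_pos Q.side_pos n).le
  have p1 : 0 ≤ 2 ^ n * (1 + 2 ^ n) * B * Q.side ^ n := by positivity
  have p2 : 0 ≤ (1 + 2 * (2 * 2 ^ n + 2 * 8 ^ n)) * B * Q.side ^ n := by positivity
  suffices hc : ∃ c, ∫ x in Q.set, |R.cutoff x * f x - c| ≤
      2 ^ n * (1 + 2 ^ n) * B * Q.side ^ n +
        (1 + 2 * (2 * 2 ^ n + 2 * 8 ^ n)) * B * Q.side ^ n by
    obtain ⟨c, hc⟩ := hc
    linarith [setIntegral_abs_sub_cubeAvg_le hφ Q c]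
  rcases le_total R.side Q.side with hQ | hQ
  · refine ⟨0, ?_⟩
    simp only [sub_zero]
    linarith [setIntegral_abs_cutoff_mul_le_of_side_le hf hB h hR hQ]
  by_cases hz : ∃ z ∈ Q.set, z ∈ R.double.set
  · obtain ⟨z, hzQ, hzR⟩ := hz
    exact ⟨_, (setIntegral_abs_cutoff_mul_sub_le_of_le_side hf hB h hR hQ hzQ hzR).trans
      (le_add_of_nonneg_left p1)⟩
  · push Not at hz
    refine ⟨0, ?_⟩
    rw [setIntegral_eq_zero_of_forall_eq_zero fun x hx => by
      simp [R.cutoff_eq_zero (hz x hx)]]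
    exact add_nonneg p1 p2

end
end

section
/- Let m ≥ 1 be an integer and p > 1. Let K be a kernel on ℝⁿ×ℝⁿ (off the diagonal) satisfying: |K(x,y)| ≤ C_K|x−y|^{−n}; the smoothness estimate |K(x,y)−K(x',y)| + |K(y,x)−K(y,x')| ≤ ω(|x−x'|/|x−y|)·|x−y|^{−n} for |x−y| > 2|x−x'|, with ω : [0,1] → [0,∞), ω(t) → 0 as t → 0; and the non-degeneracy: there is c₀ > 0 such that for every y ∈ ℝⁿ, r > 0 there is x ∉ B(y,r) with |K(x,y)| ≥ c₀r^{−n}, and the same for the transposed kernel. Let λ, μ, η be weights, and assume there is C such that for every b ∈ BMO_η and every bounded compactly supported f, ‖χ_{ℝⁿ∖supp f} · (x ↦ ∫(b(x)−b(y))^m K(x,y)f(y)dy)‖_{L^p(λ)} ≤ C·‖b‖_{BMO_η}^m·‖f‖_{L^p(μ)}. Then λ(x)·η(x)^{pm} ≤ C'·μ(x) for almost every x ∈ ℝⁿ, with C' independent of x. -/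
open MeasureTheory ENNReal Filter

noncomputable section

/-- The size condition for a Calderón–Zygmund kernel. -/
def KernelSize {n : ℕ} (K : (Fin n → ℝ) → (Fin n → ℝ) → ℝ) (CK : ℝ) : Prop :=
  ∀ x y : Fin n → ℝ, x ≠ y → |K x y| ≤ CK / dist x y ^ n

/-- The smoothness condition for a Calderón–Zygmund kernel with modulus `ω`. -/
def KernelSmooth {n : ℕ} (K : (Fin n → ℝ) → (Fin n → ℝ) → ℝ) (ω : ℝ → ℝ) : Prop :=
  ∀ x x' y : Fin n → ℝ, 2 * dist x x' < dist x y →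
    |K x y - K x' y| + |K y x - K y x'| ≤ ω (dist x x' / dist x y) / dist x y ^ n

/-- Non-degeneracy of a kernel. -/
def KernelNonDeg {n : ℕ} (K : (Fin n → ℝ) → (Fin n → ℝ) → ℝ) (c₀ : ℝ) : Prop :=
  ∀ (y : Fin n → ℝ) (r : ℝ), 0 < r →
    ∃ x : Fin n → ℝ, x ∉ Metric.ball y r ∧ c₀ / r ^ n ≤ |K x y|

/-- The weighted `BMO_η` norm. -/
def bmoWNorm {n : ℕ} (η b : (Fin n → ℝ) → ℝ) : ℝ≥0∞ :=
  ⨆ Q : Cube n, (∫⁻ x in Q.set, ENNReal.ofReal |b x - cubeAvg b Q|) /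
    (∫⁻ x in Q.set, ENNReal.ofReal (η x))

/-- The `m`-th iterated commutator of the operator with kernel `K` and of `b`,
given by an absolutely convergent integral off the support of `f`. -/
def commFn {n : ℕ} (m : ℕ) (K : (Fin n → ℝ) → (Fin n → ℝ) → ℝ)
    (b f : (Fin n → ℝ) → ℝ) (x : Fin n → ℝ) : ℝ :=
  ∫ y, (b x - b y) ^ m * K x y * f y

/-- A doubling weight: `u(2Q) ≤ c·u(Q)` for all cubes `Q`. -/
def IsDoublingWeight {n : ℕ} (u : (Fin n → ℝ) → ℝ) : Prop :=
  ∃ c : ℝ, ∀ Q : Cube n,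
    (∫⁻ x in Q.double.set, ENNReal.ofReal (u x)) ≤
      ENNReal.ofReal c * ∫⁻ x in Q.set, ENNReal.ofReal (u x)

/-- The weak `L^{p,∞}(u)` norm. -/
def weakLpNorm {n : ℕ} (p : ℝ) (u : (Fin n → ℝ) → ℝ) (g : (Fin n → ℝ) → ℝ) : ℝ≥0∞ :=
  ⨆ (t : ℝ) (_ : 0 < t),
    ENNReal.ofReal t * (∫⁻ x in {x | t < |g x|}, ENNReal.ofReal (u x)) ^ (1 / p)

/-- Smoothness of a kernel in quantitative form: small relative perturbations of either variable
change the kernel by a small multiple of `dist x y ^ (-n)`. -/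
lemma KernelSmooth.exists_forall_abs_sub_le {n : ℕ} {K : (Fin n → ℝ) → (Fin n → ℝ) → ℝ}
    {ω : ℝ → ℝ} (hK : KernelSmooth K ω)
    (hω : Tendsto ω (nhdsWithin 0 (Set.Ioi 0)) (nhds 0)) {ε : ℝ} (hε : 0 < ε) :
    ∃ δ : ℝ, 0 < δ ∧ ∀ x x' y : Fin n → ℝ, dist x x' < δ * dist x y →
      |K x y - K x' y| ≤ ε / dist x y ^ n ∧ |K y x - K y x'| ≤ ε / dist x y ^ n := by
  have h1 : ∀ᶠ t in nhdsWithin (0 : ℝ) (Set.Ioi 0), ω t < ε := hω.eventually_lt_const hε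
  obtain ⟨δ, hδ, h⟩ := mem_nhdsGT_iff_exists_Ioo_subset.1 h1
  have hδ' : 0 < δ := hδ
  refine ⟨min δ (1 / 2), by positivity, fun x x' y hxy => ?_⟩
  rcases eq_or_ne x x' with rfl | hne
  · simp only [sub_self, abs_zero]
    exact ⟨by positivity, by positivity⟩
  have hd : 0 < dist x x' := dist_pos.2 hne
  have hm : 0 < min δ (1 / 2) := by positivity
  have hxy0 : 0 < dist x y := by
    by_contra! hle
    nlinarith
  have h2 : 2 * dist x x' < dist x y := by
    nlinarith [min_le_right δ (1 / 2)]
  have h3 : dist x x' / dist x y ∈ Set.Ioo 0 δ := by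
    refine ⟨by positivity, ?_⟩
    rw [div_lt_iff₀ hxy0]
    nlinarith [min_le_left δ (1 / 2)]
  have h4 : ω (dist x x' / dist x y) < ε := h h3
  have h5 := hK x x' y h2
  have h6 : ω (dist x x' / dist x y) / dist x y ^ n ≤ ε / dist x y ^ n := by gcongr
  constructor <;> linarith [abs_nonneg (K x y - K x' y), abs_nonneg (K y x - K y x')]

lemma KernelSmooth.continuousOn {n : ℕ} {K : (Fin n → ℝ) → (Fin n → ℝ) → ℝ}
    {ω : ℝ → ℝ} (hK : KernelSmooth K ω)
    (hω : Tendsto ω (nhdsWithin 0 (Set.Ioi 0)) (nhds 0)) (x : Fin n → ℝ) :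
    ContinuousOn (K x) {x}ᶜ := by
  intro y hy
  apply ContinuousAt.continuousWithinAt
  have hd : 0 < dist y x := dist_pos.2 hy
  rw [Metric.continuousAt_iff]
  intro ε hε
  obtain ⟨δ, hδ, h⟩ := hK.exists_forall_abs_sub_le hω (ε := ε / 2 * dist y x ^ n) (by positivity)
  refine ⟨δ * dist y x, by positivity, fun {z} hz => ?_⟩
  have h1 := (h y z x (by rwa [dist_comm])).2
  rw [mul_div_assoc, div_self (by positivity), mul_one] at h1
  rw [dist_comm, Real.dist_eq]
  linarith

/-- For a non-degenerate kernel, every ball `B` has a companion ball of the same radius, at distance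
comparable to that radius, on which the integrals of the kernel over `B` are bounded below. -/
lemma KernelNonDeg.exists_companion {n : ℕ} {K : (Fin n → ℝ) → (Fin n → ℝ) → ℝ} {CK : ℝ}
    (hsize : KernelSize K CK) {ω : ℝ → ℝ}
    (hω : Tendsto ω (nhdsWithin 0 (Set.Ioi 0)) (nhds 0)) (hsmooth : KernelSmooth K ω)
    {c₀ : ℝ} (hc₀ : 0 < c₀) (hnd : KernelNonDeg K c₀) :
    ∃ D κ : ℝ, 0 < κ ∧ ∀ (y₀ : Fin n → ℝ) (r : ℝ), 0 < r → ∃ x₀ : Fin n → ℝ,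
      dist x₀ y₀ ≤ D * r ∧ 3 * r ≤ dist x₀ y₀ ∧
      ∀ x ∈ Metric.closedBall x₀ r, κ ≤ |∫ y in Metric.closedBall y₀ r, K x y| := by
  obtain ⟨δ, hδ, hclose⟩ := hsmooth.exists_forall_abs_sub_le hω
    (ε := c₀ / (2 * (1 + 2 ^ n))) (by positivity)
  set ε := c₀ / (2 * (1 + 2 ^ n)) with hεdef
  have hε : 0 < ε := by positivity
  set A : ℝ := 4 + 1 / δ with hA
  have hδi : 0 < 1 / δ := by positivity
  have hA4 : 4 ≤ A := by linarith
  have hA0 : 0 < A := by linarith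
  have hδA : 1 < δ * (A - 1) := by
    have : δ * (A - 1) = 3 * δ + 1 := by rw [hA]; field_simp; ring
    linarith
  refine ⟨max 1 (CK / c₀) * A, 2 ^ n * (c₀ / A ^ n / 2), by positivity, fun y₀ r hr => ?_⟩
  obtain ⟨x₀, hx₀, ha⟩ := hnd y₀ (A * r) (by positivity)
  have hd : A * r ≤ dist x₀ y₀ := by simpa using hx₀
  have hAr : 0 < A * r := by positivity
  have hd0 : 0 < dist x₀ y₀ := hAr.trans_le hd
  have hne : x₀ ≠ y₀ := dist_pos.1 hd0
  have hn : n ≠ 0 := by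
    rintro rfl
    exact hne (Subsingleton.elim _ _)
  refine ⟨x₀, ?_, by nlinarith, fun x hx => ?_⟩
  · have h1 : c₀ / (A * r) ^ n ≤ CK / dist x₀ y₀ ^ n := ha.trans (hsize _ _ hne)
    rw [div_le_div_iff₀ (by positivity) (by positivity)] at h1
    have h2 : dist x₀ y₀ ^ n ≤ (max 1 (CK / c₀) * A * r) ^ n := by
      have h3 : dist x₀ y₀ ^ n ≤ CK / c₀ * (A * r) ^ n := by
        rw [div_mul_eq_mul_div, le_div_iff₀ hc₀]
        linarith
      rw [mul_assoc, mul_pow]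
      refine h3.trans ?_
      gcongr
      exact (le_max_right _ _).trans (le_self_pow₀ (le_max_left _ _) hn)
    exact le_of_pow_le_pow_left₀ hn (by positivity) h2
  · have hxr : dist x x₀ ≤ r := hx
    have hxy : (A - 1) * r ≤ dist y₀ x := by
      have := dist_triangle x₀ x y₀
      rw [dist_comm x₀ x, dist_comm x y₀] at this
      linarith
    have hnear : ∀ y ∈ Metric.closedBall y₀ r, ‖K x y - K x₀ y₀‖ ≤ |K x₀ y₀| / 2 := by
      intro y hy
      have hyr : dist y₀ y ≤ r := by rw [dist_comm]; exact hy
      have h1 := (hclose x₀ x y₀ (by rw [dist_comm]; nlinarith)).1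
      have h2 := (hclose y₀ y x (by nlinarith)).2
      have h3 : ε / dist x₀ y₀ ^ n ≤ ε / (A * r) ^ n := by gcongr
      have h4 : ε / dist y₀ x ^ n ≤ ε * 2 ^ n / (A * r) ^ n := by
        have : ε * 2 ^ n / (A * r) ^ n = ε / (A * r / 2) ^ n := by
          rw [div_pow]; field_simp
        rw [this]
        gcongr
        nlinarith
      have h5 : ε / (A * r) ^ n + ε * 2 ^ n / (A * r) ^ n = c₀ / (A * r) ^ n / 2 := by
        rw [hεdef]; field_simp
      rw [Real.norm_eq_abs, abs_sub_comm]
      have h6 := abs_sub_le (K x₀ y₀) (K x y₀) (K x y)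
      linarith
    have hsub : Metric.closedBall y₀ r ⊆ {x}ᶜ := by
      rintro y hy rfl
      have hyr : dist y₀ y ≤ r := by rw [dist_comm]; exact hy
      nlinarith
    have hint : IntegrableOn (K x) (Metric.closedBall y₀ r) :=
      ((hsmooth.continuousOn hω x).mono hsub).integrableOn_compact (isCompact_closedBall _ _)
    have hfin : volume (Metric.closedBall y₀ r) < ⊤ := measure_closedBall_lt_top
    have hvol : volume.real (Metric.closedBall y₀ r) = 2 ^ n * r ^ n := by
      rw [measureReal_def, Real.volume_pi_closedBall _ hr.le, ENNReal.toReal_ofReal (by positivity),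
        Fintype.card_fin, mul_pow]
    have h1 := norm_setIntegral_le_of_norm_le_const (μ := volume) hfin hnear
    rw [integral_sub hint (integrableOn_const hfin.ne), setIntegral_const, hvol, smul_eq_mul,
      Real.norm_eq_abs] at h1
    have h2 := abs_sub_abs_le_abs_sub (2 ^ n * r ^ n * K x₀ y₀)
      (∫ y in Metric.closedBall y₀ r, K x y)
    rw [abs_sub_comm, abs_mul, abs_of_nonneg (by positivity : (0 : ℝ) ≤ 2 ^ n * r ^ n)] at h2
    have h3 : 2 ^ n * (c₀ / A ^ n / 2) ≤ 2 ^ n * r ^ n * (|K x₀ y₀| / 2) := by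
      have : 2 ^ n * (c₀ / A ^ n / 2) = 2 ^ n * r ^ n * (c₀ / (A * r) ^ n / 2) := by
        rw [mul_pow]; field_simp
      rw [this]
      gcongr
    linarith

/-- A function dominated by `η` has `BMO_η` norm at most `2`. -/
lemma bmoWNorm_le_two {n : ℕ} {η b : (Fin n → ℝ) → ℝ} (hb : LocallyIntegrable b volume)
    (hb0 : ∀ x, 0 ≤ b x) (hbη : ∀ x, b x ≤ η x) : bmoWNorm η b ≤ 2 := by
  refine iSup_le fun Q => ENNReal.div_le_of_le_mul ?_
  have hsub : Q.set ⊆ Set.Icc Q.corner (fun i => Q.corner i + Q.side) := by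
    intro x hx
    exact ⟨fun i => (hx i trivial).1, fun i => (hx i trivial).2.le⟩
  have hfin : volume Q.set ≠ ⊤ :=
    ((measure_mono hsub).trans_lt isCompact_Icc.measure_lt_top).ne
  have hint : IntegrableOn b Q.set := (hb.integrableOn_isCompact isCompact_Icc).mono_set hsub
  have hI : 0 ≤ ∫ x in Q.set, b x := integral_nonneg hb0
  have havg : 0 ≤ cubeAvg b Q := div_nonneg hI ENNReal.toReal_nonneg
  have hIeq : ENNReal.ofReal (∫ x in Q.set, b x) = ∫⁻ x in Q.set, ENNReal.ofReal (b x) :=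
    ofReal_integral_eq_lintegral_ofReal hint (ae_of_all _ hb0)
  calc ∫⁻ x in Q.set, ENNReal.ofReal |b x - cubeAvg b Q|
      ≤ ∫⁻ x in Q.set, (ENNReal.ofReal (b x) + ENNReal.ofReal (cubeAvg b Q)) := by
        refine lintegral_mono fun x => ?_
        rw [← ENNReal.ofReal_add (hb0 x) havg]
        refine ENNReal.ofReal_le_ofReal (abs_le.2 ⟨?_, ?_⟩) <;> linarith [hb0 x]
    _ = (∫⁻ x in Q.set, ENNReal.ofReal (b x)) + ENNReal.ofReal (cubeAvg b Q) * volume Q.set := by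
        rw [lintegral_add_right _ measurable_const, setLIntegral_const]
    _ ≤ (∫⁻ x in Q.set, ENNReal.ofReal (b x)) + ∫⁻ x in Q.set, ENNReal.ofReal (b x) := by
        gcongr
        rw [← hIeq]
        nth_rewrite 1 [← ENNReal.ofReal_toReal hfin]
        rw [← ENNReal.ofReal_mul havg]
        refine ENNReal.ofReal_le_ofReal ?_
        rcases eq_or_ne (volume Q.set).toReal 0 with h | h
        · rw [h, mul_zero]; exact hI
        · exact (div_mul_cancel₀ _ h).le
    _ = 2 * ∫⁻ x in Q.set, ENNReal.ofReal (b x) := (two_mul _).symm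
    _ ≤ 2 * ∫⁻ x in Q.set, ENNReal.ofReal (η x) := by
        gcongr with x
        exact hbη x

/-- Averages over companion balls determine pointwise inequalities almost everywhere. -/
lemma ae_le_mul_of_companion_setLIntegral_le {n : ℕ} {u v : (Fin n → ℝ) → ℝ} (hu : Measurable u)
    (hu0 : ∀ x, 0 ≤ u x) (hv : LocallyIntegrable v volume) (hv0 : ∀ x, 0 ≤ v x) {D M : ℝ}
    (hM : 0 ≤ M)
    (h : ∀ (y : Fin n → ℝ) (r : ℝ), 0 < r → ∃ x : Fin n → ℝ, dist x y ≤ D * r ∧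
      (∫⁻ z in Metric.closedBall x r, ENNReal.ofReal (u z)) ≤
        ENNReal.ofReal M * ∫⁻ z in Metric.closedBall y r, ENNReal.ofReal (v z)) :
    ∀ᵐ y ∂(volume : Measure (Fin n → ℝ)), u y ≤ M * v y := by
  have hlim : Tendsto (fun j : ℕ => 1 / ((j : ℝ) + 1)) atTop (nhdsWithin 0 (Set.Ioi 0)) :=
    tendsto_nhdsWithin_iff.2 ⟨tendsto_one_div_add_atTop_nhds_zero_nat,
      Eventually.of_forall fun _ => Set.mem_Ioi.2 Nat.one_div_pos_of_nat⟩
  have hg : ∀ N : ℕ, LocallyIntegrable (fun x => min (u x) (N : ℝ)) volume := fun N =>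
    (locallyIntegrable_const (N : ℝ)).mono (hu.min measurable_const).aestronglyMeasurable
      (ae_of_all _ fun x => by
        rw [Real.norm_of_nonneg (le_min (hu0 x) N.cast_nonneg),
          Real.norm_of_nonneg (N.cast_nonneg)]
        exact min_le_right _ _)
  have hgae := ae_all_iff.2 fun N : ℕ =>
    IsUnifLocDoublingMeasure.ae_tendsto_average volume (hg N) D
  filter_upwards [hgae, IsUnifLocDoublingMeasure.ae_tendsto_average volume hv 0] with y hgy hvy
  have hpos : ∀ j : ℕ, 0 < 1 / ((j : ℝ) + 1) := fun j => Nat.one_div_pos_of_nat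
  choose x hxd hx using fun j : ℕ => h y (1 / ((j : ℝ) + 1)) (hpos j)
  have hvlim := hvy (fun _ : ℕ => y) _ hlim (Eventually.of_forall fun j => by simp)
  obtain ⟨N, hN⟩ := exists_nat_ge (u y)
  have hglim := hgy N x _ hlim (Eventually.of_forall fun j => by
    rw [Metric.mem_closedBall, dist_comm]; exact hxd j)
  rw [min_eq_left hN] at hglim
  refine le_of_tendsto_of_tendsto' hglim (hvlim.const_mul M) fun j => ?_
  set r : ℝ := 1 / ((j : ℝ) + 1)
  have hr0 : 0 ≤ r := (hpos j).le
  have hvol : volume.real (Metric.closedBall (x j) r) = volume.real (Metric.closedBall y r) := by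
    simp only [measureReal_def, Real.volume_pi_closedBall _ hr0]
  rw [setAverage_eq, setAverage_eq, hvol, smul_eq_mul, smul_eq_mul, mul_left_comm]
  refine mul_le_mul_of_nonneg_left ?_ (inv_nonneg.2 measureReal_nonneg)
  have hgint := (hg N).integrableOn_isCompact (isCompact_closedBall (x j) r)
  have hvint := hv.integrableOn_isCompact (isCompact_closedBall y r)
  have hvI : 0 ≤ ∫ z in Metric.closedBall y r, v z := integral_nonneg hv0
  rw [← ENNReal.ofReal_le_ofReal_iff (mul_nonneg hM hvI), ENNReal.ofReal_mul hM,
    ofReal_integral_eq_lintegral_ofReal hgint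
      (ae_of_all _ fun z => le_min (hu0 z) N.cast_nonneg),
    ofReal_integral_eq_lintegral_ofReal hvint (ae_of_all _ hv0)]
  refine le_trans (lintegral_mono fun z => ?_) (hx j)
  exact ENNReal.ofReal_le_ofReal (min_le_left _ _)

/-- **Corollary (pointwise necessary condition): `λ η^{pm} ≲ μ` a.e.** -/
theorem pointwise_weight_necessary (n : ℕ) (m : ℕ) (hm : 1 ≤ m) (p : ℝ) (hp : 1 < p)
    (K : (Fin n → ℝ) → (Fin n → ℝ) → ℝ) (CK : ℝ) (hsize : KernelSize K CK)
    (ω : ℝ → ℝ) (hω0 : ∀ t, 0 ≤ ω t)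
    (hωlim : Tendsto ω (nhdsWithin 0 (Set.Ioi 0)) (nhds 0))
    (hsmooth : KernelSmooth K ω)
    (c₀ : ℝ) (hc₀ : 0 < c₀) (hnd : KernelNonDeg K c₀)
    (hnd' : KernelNonDeg (fun x y => K y x) c₀)
    (lam mu eta : (Fin n → ℝ) → ℝ)
    (hlam : IsWeight lam) (hmu : IsWeight mu) (heta : IsWeight eta)
    (C : ℝ)
    (hbound : ∀ b : (Fin n → ℝ) → ℝ, LocallyIntegrable b volume →
      bmoWNorm eta b < ⊤ →
      ∀ f : (Fin n → ℝ) → ℝ, Measurable f → (∃ M : ℝ, ∀ x, |f x| ≤ M) →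
        HasCompactSupport f →
        lpNormR p lam (Set.indicator (tsupport f)ᶜ (commFn m K b f)) ≤
          ENNReal.ofReal C * bmoWNorm eta b ^ m * lpNormR p mu f) :
    ∃ C' : ℝ, 0 ≤ C' ∧
      ∀ᵐ x ∂(volume : Measure (Fin n → ℝ)),
        lam x * eta x ^ (p * (m : ℝ)) ≤ C' * mu x := by
  obtain ⟨D, κ, hκ, hcomp⟩ := hnd.exists_companion hsize hωlim hsmooth hc₀
  have hp0 : 0 < p := by linarith
  set L : ℝ := max C 0 * 2 ^ m with hL
  have hL0 : 0 ≤ L := by positivity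
  refine ⟨(L / κ) ^ p, by positivity, ?_⟩
  refine ae_le_mul_of_companion_setLIntegral_le (D := D)
    (hlam.1.mul (heta.1.pow_const _))
    (fun x => mul_nonneg (hlam.2.1 x) (Real.rpow_nonneg (heta.2.1 x) _)) hmu.2.2 hmu.2.1
    (by positivity) fun y₀ r hr => ?_
  obtain ⟨x₀, hxD, hx3, hx⟩ := hcomp y₀ r hr
  refine ⟨x₀, hxD, ?_⟩
  set B := Metric.closedBall y₀ r
  set B' := Metric.closedBall x₀ r
  have hBm : MeasurableSet B := Metric.isClosed_closedBall.measurableSet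
  have hBm' : MeasurableSet B' := Metric.isClosed_closedBall.measurableSet
  have hdisj : Disjoint B' B := Metric.closedBall_disjoint_closedBall (by linarith)
  set b : (Fin n → ℝ) → ℝ := B'.indicator eta with hb
  set f : (Fin n → ℝ) → ℝ := B.indicator (fun _ => 1) with hf
  have hbint : LocallyIntegrable b volume := heta.2.2.indicator hBm'
  have hbmo : bmoWNorm eta b ≤ 2 := bmoWNorm_le_two hbint
    (Set.indicator_nonneg fun x _ => heta.2.1 x)
    (Set.indicator_le_self' fun x _ => heta.2.1 x)
  have htf : tsupport f ⊆ B :=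
    closure_minimal Set.support_indicator_subset Metric.isClosed_closedBall
  have hcomm : ∀ x ∈ B', commFn m K b f x = eta x ^ m * ∫ y in B, K x y := by
    intro x hxB
    rw [← integral_const_mul, ← integral_indicator hBm]
    refine integral_congr_ae (ae_of_all _ fun y => ?_)
    by_cases hy : y ∈ B
    · have hy' : y ∉ B' := Set.disjoint_right.1 hdisj hy
      simp [hb, hf, hy, hy', hxB]
    · simp [hf, hy]
  have key := hbound b hbint (hbmo.trans_lt (by simp)) f (measurable_const.indicator hBm)
    ⟨1, fun x => by by_cases h : x ∈ B <;> simp [hf, h]⟩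
    (HasCompactSupport.of_support_subset_isCompact (isCompact_closedBall y₀ r)
      Set.support_indicator_subset)
  have hC : ENNReal.ofReal C * bmoWNorm eta b ^ m ≤ ENNReal.ofReal L := by
    rw [hL, ENNReal.ofReal_mul (by positivity), ENNReal.ofReal_pow (by norm_num)]
    gcongr
    · exact le_max_left _ _
    · simpa using hbmo
  have hright : ∫⁻ x, ENNReal.ofReal |f x| ^ p * ENNReal.ofReal (mu x) =
      ∫⁻ x in B, ENNReal.ofReal (mu x) := by
    rw [← lintegral_indicator hBm]
    refine lintegral_congr fun x => ?_
    by_cases h : x ∈ B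
    · simp [hf, h]
    · simp [hf, h, hp0]
  have hleft : ENNReal.ofReal (κ ^ p) *
      ∫⁻ x in B', ENNReal.ofReal (lam x * eta x ^ (p * (m : ℝ))) ≤
      ∫⁻ x, ENNReal.ofReal |(tsupport f)ᶜ.indicator (commFn m K b f) x| ^ p *
        ENNReal.ofReal (lam x) := by
    rw [← lintegral_const_mul' _ _ ENNReal.ofReal_ne_top]
    refine le_trans ?_ (setLIntegral_le_lintegral B' _)
    refine setLIntegral_mono' hBm' fun x hxB => ?_
    have hxt : x ∈ (tsupport f)ᶜ := fun h => Set.disjoint_left.1 hdisj hxB (htf h)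
    have he := heta.2.1 x
    rw [Set.indicator_of_mem hxt, hcomm x hxB, abs_mul, abs_of_nonneg (pow_nonneg he m),
      ENNReal.ofReal_rpow_of_nonneg (by positivity) hp0.le,
      ← ENNReal.ofReal_mul (by positivity), ← ENNReal.ofReal_mul (by positivity)]
    refine ENNReal.ofReal_le_ofReal ?_
    have h1 : eta x ^ (p * (m : ℝ)) = (eta x ^ m) ^ p := by
      rw [mul_comm, Real.rpow_mul he, Real.rpow_natCast]
    calc κ ^ p * (lam x * eta x ^ (p * (m : ℝ))) = (eta x ^ m * κ) ^ p * lam x := by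
          rw [h1, Real.mul_rpow (by positivity) hκ.le]; ring
      _ ≤ _ := by
          have := hlam.2.1 x
          gcongr
          exact hx x hxB
  have key2 : ENNReal.ofReal (κ ^ p) *
      ∫⁻ x in B', ENNReal.ofReal (lam x * eta x ^ (p * (m : ℝ))) ≤
      ENNReal.ofReal (L ^ p) * ∫⁻ x in B, ENNReal.ofReal (mu x) := by
    have h1 := key.trans (mul_le_mul_left hC _)
    unfold lpNormR at h1
    have h2 := ENNReal.rpow_le_rpow h1 hp0.le
    rw [ENNReal.mul_rpow_of_nonneg _ _ hp0.le, ← ENNReal.rpow_mul, ← ENNReal.rpow_mul,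
      one_div_mul_cancel hp0.ne', ENNReal.rpow_one, ENNReal.rpow_one, hright,
      ENNReal.ofReal_rpow_of_nonneg hL0 hp0.le] at h2
    exact hleft.trans h2
  have hκp : 0 < κ ^ p := by positivity
  rw [Real.div_rpow hL0 hκ.le, ENNReal.ofReal_div_of_pos hκp, ENNReal.div_eq_inv_mul, mul_assoc,
    ← ENNReal.mul_le_iff_le_inv (by simpa using hκp) ENNReal.ofReal_ne_top]
  exact key2

end
end

section
/- Let Φ be a Young function which is submultiplicative with constant κ ≥ 1, i.e. Φ(ab) ≤ κ·Φ(a)·Φ(b) for all a, b ≥ 0. Let J ⊆ I be intervals in ℝ. Then for every measurable f, ‖f‖_{Φ,J} ≤ ‖f‖_{Φ,I} / Φ^{−1}((1/κ)·(|J|/|I|)), where Φ^{−1} is the inverse function of Φ. Moreover, if I, J are intervals in ℝ with |J∩I| > 0 and f is supported in I, then ‖f‖_{Φ,J} ≤ ‖f‖_{Φ,J∩I} / Φ^{−1}((1/κ)·(|J|/|J∩I|)). -/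
open MeasureTheory ENNReal Filter

noncomputable section

/-- The normalized Luxemburg norm over a set `J ⊆ ℝ` (with value `∞` if no λ works). -/
def luxNorm1 (φ : ℝ → ℝ) (J : Set ℝ) (f : ℝ → ℝ) : ℝ≥0∞ :=
  sInf {l : ℝ≥0∞ | ∃ c : ℝ, 0 < c ∧ l = ENNReal.ofReal c ∧
    (∫⁻ x in J, ENNReal.ofReal (φ (|f x| / c))) ≤ volume J}

/-- A Young function. -/
def IsYoung (φ : ℝ → ℝ) : Prop :=
  ContinuousOn φ (Set.Ici 0) ∧ ConvexOn ℝ (Set.Ici 0) φ ∧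
  StrictMonoOn φ (Set.Ici 0) ∧ φ 0 = 0 ∧
  Tendsto (fun t => φ t / t) atTop atTop

/-- The (generalized) inverse function of an increasing function. -/
def genInv (φ : ℝ → ℝ) (t : ℝ) : ℝ :=
  sInf {s : ℝ | 0 ≤ s ∧ t ≤ φ s}

/-- A Young function attains every nonnegative value at its generalized inverse. -/
theorem IsYoung.apply_genInv {φ : ℝ → ℝ} (hφ : IsYoung φ) {r : ℝ} (hr : 0 ≤ r) :
    φ (genInv φ r) = r := by
  obtain ⟨hcont, -, hmono, h0, hlim⟩ := hφ
  obtain ⟨t, ht, ht1⟩ := ((hlim.eventually_ge_atTop r).and (eventually_ge_atTop 1)).exists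
  have hrt : r ≤ φ t := by
    rw [le_div_iff₀ (by linarith)] at ht
    nlinarith
  obtain ⟨s, hs, rfl⟩ := intermediate_value_Icc (by linarith : (0 : ℝ) ≤ t)
    (hcont.mono Set.Icc_subset_Ici_self) (Set.mem_Icc.2 ⟨h0.trans_le hr, hrt⟩)
  have hleast : IsLeast {u : ℝ | 0 ≤ u ∧ φ s ≤ φ u} s :=
    ⟨⟨hs.1, le_rfl⟩, fun u hu => (hmono.le_iff_le hs.1 hu.1).1 hu.2⟩
  rw [genInv, hleast.csInf_eq]

theorem genInv_nonneg (φ : ℝ → ℝ) (r : ℝ) : 0 ≤ genInv φ r :=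
  Real.sInf_nonneg fun _ h => h.1

theorem IsYoung.genInv_pos {φ : ℝ → ℝ} (hφ : IsYoung φ) {r : ℝ} (hr : 0 < r) :
    0 < genInv φ r := by
  refine (genInv_nonneg φ r).lt_of_ne fun h => ?_
  have h1 := hφ.apply_genInv hr.le
  rw [← h, hφ.2.2.2.1] at h1
  exact hr.ne h1

/-- Comparison of Luxemburg norms over two sets, for a submultiplicative Young function whose
modulars of `f` over `A` are dominated by those over `B`. -/
theorem luxNorm1_le_div_genInv {φ : ℝ → ℝ} (hφ : IsYoung φ) {κ : ℝ} (hκ : 0 < κ)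
    (hsub : ∀ a b : ℝ, 0 ≤ a → 0 ≤ b → φ (a * b) ≤ κ * φ a * φ b)
    {A B : Set ℝ} {a b : ℝ} (ha : 0 < a) (hb : 0 < b)
    (hA : volume A = ENNReal.ofReal a) (hB : volume B = ENNReal.ofReal b) (f : ℝ → ℝ)
    (hf : ∀ c : ℝ, ∫⁻ x in A, ENNReal.ofReal (φ (|f x| / c)) ≤
      ∫⁻ x in B, ENNReal.ofReal (φ (|f x| / c))) :
    luxNorm1 φ A f ≤ luxNorm1 φ B f / ENNReal.ofReal (genInv φ (1 / κ * (a / b))) := by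
  have hr : 0 < 1 / κ * (a / b) := by positivity
  have hs := hφ.genInv_pos hr
  have hφs := hφ.apply_genInv hr.le
  set s := genInv φ (1 / κ * (a / b))
  rw [ENNReal.le_div_iff_mul_le (Or.inl (ENNReal.ofReal_pos.2 hs).ne')
    (Or.inl ENNReal.ofReal_ne_top)]
  refine le_sInf ?_
  rintro _ ⟨c, hc, rfl, hint⟩
  rw [← ENNReal.le_div_iff_mul_le (Or.inl (ENNReal.ofReal_pos.2 hs).ne')
    (Or.inl ENNReal.ofReal_ne_top), ← ENNReal.ofReal_div_of_pos hs]
  refine sInf_le ⟨c / s, div_pos hc hs, rfl, (hf _).trans ?_⟩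
  calc ∫⁻ x in B, ENNReal.ofReal (φ (|f x| / (c / s)))
      ≤ ∫⁻ x in B, ENNReal.ofReal (a / b) * ENNReal.ofReal (φ (|f x| / c)) := by
        refine lintegral_mono fun x => ?_
        rw [← ENNReal.ofReal_mul (by positivity)]
        refine ENNReal.ofReal_le_ofReal ?_
        have h := hsub s (|f x| / c) hs.le (by positivity)
        rw [hφs] at h
        convert h using 1
        · congr 1
          field_simp
        · field_simp
    _ = ENNReal.ofReal (a / b) * ∫⁻ x in B, ENNReal.ofReal (φ (|f x| / c)) :=
        lintegral_const_mul' _ _ ENNReal.ofReal_ne_top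
    _ ≤ ENNReal.ofReal (a / b) * volume B := by gcongr
    _ = volume A := by
        rw [hA, hB, ← ENNReal.ofReal_mul (by positivity), div_mul_cancel₀ _ hb.ne']

/-- **Propositions: Luxemburg norms over a subinterval and over the intersection with
the support, for a submultiplicative Young function.** -/
theorem luxNorm_subinterval_and_support (Φ : ℝ → ℝ) (hΦ : IsYoung Φ)
    (κ : ℝ) (hκ : 1 ≤ κ)
    (hsub : ∀ a b : ℝ, 0 ≤ a → 0 ≤ b → Φ (a * b) ≤ κ * Φ a * Φ b) :
    (∀ aI bI aJ bJ : ℝ, aI ≤ aJ → aJ < bJ → bJ ≤ bI →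
      ∀ f : ℝ → ℝ,
        luxNorm1 Φ (Set.Ioc aJ bJ) f ≤
          luxNorm1 Φ (Set.Ioc aI bI) f /
            ENNReal.ofReal (genInv Φ (1 / κ * ((bJ - aJ) / (bI - aI))))) ∧
    (∀ aI bI aJ bJ : ℝ, aI < bI → aJ < bJ →
      0 < volume (Set.Ioc aJ bJ ∩ Set.Ioc aI bI) →
      ∀ f : ℝ → ℝ, Function.support f ⊆ Set.Ioc aI bI →
        luxNorm1 Φ (Set.Ioc aJ bJ) f ≤
          luxNorm1 Φ (Set.Ioc aJ bJ ∩ Set.Ioc aI bI) f /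
            ENNReal.ofReal (genInv Φ (1 / κ *
              ((bJ - aJ) / (volume (Set.Ioc aJ bJ ∩ Set.Ioc aI bI)).toReal)))) := by
  have hκ0 : 0 < κ := one_pos.trans_le hκ
  refine ⟨fun aI bI aJ bJ h1 h2 h3 f => ?_, fun aI bI aJ bJ hI hJ hpos f hf => ?_⟩
  · exact luxNorm1_le_div_genInv hΦ hκ0 hsub (sub_pos.2 h2) (by linarith) Real.volume_Ioc
      Real.volume_Ioc f fun c => lintegral_mono_set (Set.Ioc_subset_Ioc h1 h3)
  · have hfin : volume (Set.Ioc aJ bJ ∩ Set.Ioc aI bI) ≠ ∞ :=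
      measure_ne_top_of_subset Set.inter_subset_left measure_Ioc_lt_top.ne
    refine luxNorm1_le_div_genInv hΦ hκ0 hsub (sub_pos.2 hJ)
      (ENNReal.toReal_pos hpos.ne' hfin) Real.volume_Ioc (ENNReal.ofReal_toReal hfin).symm f
      fun c => le_of_eq ?_
    rw [Set.inter_comm, ← setLIntegral_indicator measurableSet_Ioc, Set.indicator_eq_self.2]
    refine fun x hx => hf fun hfx => hx ?_
    simp [hfx, hΦ.2.2.2.1]

end
end
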